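/- arXiv:2603.21587 — 2 statements merged into one kernel-verified Lean document; each statement's English description precedes it below -/
import Mathlib

section
/- Let (R,𝔪) be a Cohen-Macaulay local ring with canonical module that is generically Gorenstein and not Gorenstein, let ω be a canonical ideal of R, let x ∈ ω be an R-regular element, and set (ω/xR)^∨ := Ext^1_R(ω/xR, ω). Then exactly one of the following holds: (1) R ⊕ X_{(ω/xR)^∨} ≅ X_{R/xR}; (2) R ⊕ X_{(ω/xR)^∨} ≅ ω ⊕ X_{R/xR}. Here X_M denotes the MCM part of the minimal MCM approximation of M. -/
open CategoryTheory

noncomputable section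

/-- The Ext module `Ext^n_R(M, N)` for `R`-modules `M`, `N`. -/
abbrev ModExt (R : Type) [CommRing R] (n : ℕ) (M N : ModuleCat R) : ModuleCat R :=
  ((Ext R (ModuleCat R) n).obj (Opposite.op M)).obj N

/-- An `R`-module `M` has finite injective dimension if `Ext^i_R(-, M)` vanishes
for all `i` beyond some bound. -/
def HasFiniteInjDim (R : Type) [CommRing R] (M : ModuleCat R) : Prop :=
  ∃ n : ℕ, ∀ (N : ModuleCat R) (i : ℕ), n < i → Subsingleton (ModExt R i N M)

/-- The depth of a module over a local ring, via Rees' characterization: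
the least `n` with `Ext^n(k, M) ≠ 0`. -/
def moduleDepth (R : Type) [CommRing R] [IsLocalRing R] (M : ModuleCat R) : ℕ∞ :=
  sInf {n : ℕ∞ | ∃ m : ℕ, n = (m : ℕ∞) ∧
    Nontrivial (ModExt R m (ModuleCat.of R (IsLocalRing.ResidueField R)) M)}

/-- A Noetherian local ring is Cohen-Macaulay if its depth equals its Krull dimension. -/
def IsCMLocalRing (R : Type) [CommRing R] [IsLocalRing R] : Prop :=
  IsNoetherianRing R ∧
    (moduleDepth R (ModuleCat.of R R) : WithBot ℕ∞) = ringKrullDim R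

/-- A maximal Cohen-Macaulay module: finitely generated with depth equal to `dim R`. -/
def IsMCM (R : Type) [CommRing R] [IsLocalRing R] (X : ModuleCat R) : Prop :=
  Module.Finite R X ∧ (moduleDepth R X : WithBot ℕ∞) = ringKrullDim R

/-- A Cohen-Macaulay module of codimension one:
`depth M = dim M = dim R - 1`. -/
def IsCMofCodimOne (R : Type) [CommRing R] [IsLocalRing R] (M : ModuleCat R) : Prop :=
  Module.Finite R M ∧ ∃ d : ℕ, ringKrullDim R = ((d + 1 : ℕ) : WithBot ℕ∞) ∧
    moduleDepth R M = (d : ℕ∞) ∧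
    ringKrullDim (R ⧸ Module.annihilator R M) = ((d : ℕ) : WithBot ℕ∞)

/-- A Gorenstein local ring: Noetherian local with finite injective dimension over itself. -/
def IsGorensteinLocalRing (A : Type) [CommRing A] : Prop :=
  IsNoetherianRing A ∧ IsLocalRing A ∧ HasFiniteInjDim A (ModuleCat.of A A)

/-- `R` is generically Gorenstein if its localization at every minimal prime is Gorenstein. -/
def IsGenericallyGorenstein (R : Type) [CommRing R] : Prop :=
  ∀ p ∈ minimalPrimes R, ∀ h : p.IsPrime,
    letI := h
    IsGorensteinLocalRing (Localization.AtPrime p)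

/-- A canonical module of a local ring `R`: finitely generated, of finite injective
dimension, with `Ext^i(k, ω) ≅ k` for `i = dim R` and `Ext^i(k, ω) = 0` otherwise. -/
def IsCanonicalModule (R : Type) [CommRing R] [IsLocalRing R] (W : ModuleCat R) : Prop :=
  Module.Finite R W ∧ HasFiniteInjDim R W ∧
    ∃ d : ℕ, ringKrullDim R = (d : ℕ) ∧
      Nonempty ((ModExt R d (ModuleCat.of R (IsLocalRing.ResidueField R)) W) ≃ₗ[R]
        IsLocalRing.ResidueField R) ∧
      ∀ i : ℕ, i ≠ d →
        Subsingleton (ModExt R i (ModuleCat.of R (IsLocalRing.ResidueField R)) W)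

/-- A canonical ideal: an ideal of `R` which, as an `R`-module, is a canonical module. -/
def IsCanonicalIdeal (R : Type) [CommRing R] [IsLocalRing R] (I : Ideal R) : Prop :=
  IsCanonicalModule R (ModuleCat.of R I)

/-- `Y` and `X` have a common nonzero direct summand via the map `ι : Y → X`. -/
def HasCommonSummandVia (R : Type) [CommRing R] {Y X : ModuleCat R}
    (ι : Y →ₗ[R] X) : Prop :=
  ∃ (N Y' X' : ModuleCat.{0} R), Nontrivial N ∧
    ∃ (e : Y ≃ₗ[R] N × Y') (f : X ≃ₗ[R] N × X') (ι' : Y' →ₗ[R] X'),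
      ∀ y : Y, f (ι y) = ((e y).1, ι' (e y).2)

/-- `0 → Y → X → M → 0` is an MCM approximation of `M`. -/
def IsMCMApprox (R : Type) [CommRing R] [IsLocalRing R] (M Y X : ModuleCat R)
    (ι : Y →ₗ[R] X) (π : X →ₗ[R] M) : Prop :=
  Module.Finite R M ∧ Module.Finite R Y ∧ IsMCM R X ∧ HasFiniteInjDim R Y ∧
    Function.Injective ι ∧ Function.Surjective π ∧ Function.Exact ι π

/-- `0 → Y → X → M → 0` is a minimal MCM approximation of `M`. -/
def IsMinMCMApprox (R : Type) [CommRing R] [IsLocalRing R] (M Y X : ModuleCat R)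
    (ι : Y →ₗ[R] X) (π : X →ₗ[R] M) : Prop :=
  IsMCMApprox R M Y X ι π ∧ ¬ HasCommonSummandVia R ι

/-- `0 → M → Y → X → 0` is an FID hull of `M`. -/
def IsFIDHull (R : Type) [CommRing R] [IsLocalRing R] (M Y X : ModuleCat R)
    (ι : M →ₗ[R] Y) (π : Y →ₗ[R] X) : Prop :=
  Module.Finite R M ∧ Module.Finite R Y ∧ HasFiniteInjDim R Y ∧
    (IsMCM R X ∨ Subsingleton X) ∧
    Function.Injective ι ∧ Function.Surjective π ∧ Function.Exact ι π

/-- `0 → M → Y → X → 0` is a minimal FID hull of `M`. -/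
def IsMinFIDHull (R : Type) [CommRing R] [IsLocalRing R] (M Y X : ModuleCat R)
    (ι : M →ₗ[R] Y) (π : Y →ₗ[R] X) : Prop :=
  IsFIDHull R M Y X ι π ∧ ¬ HasCommonSummandVia R π

/-- The free rank of a module: the largest `m` with `R^m` a direct summand. -/
def freeRank (R : Type) [CommRing R] (X : ModuleCat R) : ℕ∞ :=
  sSup {n : ℕ∞ | ∃ m : ℕ, n = (m : ℕ∞) ∧
    ∃ X' : ModuleCat.{0} R, Nonempty (X ≃ₗ[R] ((Fin m → R) × X'))}

/-- The `W`-rank of a module: the largest `m` with `W^m` a direct summand. -/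
def wRank (R : Type) [CommRing R] (W X : ModuleCat R) : ℕ∞ :=
  sSup {n : ℕ∞ | ∃ m : ℕ, n = (m : ℕ∞) ∧
    ∃ X' : ModuleCat.{0} R, Nonempty (X ≃ₗ[R] ((Fin m → W) × X'))}

/-- `M` and `N` are `W`-stably isomorphic. -/
def WStablyIso (R : Type) [CommRing R] (W M N : ModuleCat R) : Prop :=
  ∃ s t : ℕ, Nonempty ((M × (Fin s → W)) ≃ₗ[R] (N × (Fin t → W)))

/-- The quotient module `I/J` (realized as `I` modulo the elements of `J` lying in `I`). -/
abbrev qmod (R : Type) [CommRing R] (I J : Ideal R) : ModuleCat R :=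
  ModuleCat.of R (I ⧸ (Submodule.comap I.subtype J))

namespace ExtTools

open Abelian Pointwise

variable {R : Type} [CommRing R]

/-- The residue field as an object of `ModuleCat R`. -/
abbrev resField (R : Type) [CommRing R] [IsLocalRing R] : ModuleCat.{0} R :=
  ModuleCat.of R (IsLocalRing.ResidueField R)

section LongExactSequences

variable {S : ShortComplex (ModuleCat.{0} R)} (hS : S.ShortExact)

include hS

lemma subsingleton_covariant₃ (X : ModuleCat.{0} R) (i : ℕ)
    (h₂ : Subsingleton (Abelian.Ext X S.X₂ i)) (h₁ : Subsingleton (Abelian.Ext X S.X₁ (i + 1))) :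
    Subsingleton (Abelian.Ext X S.X₃ i) := by
  refine subsingleton_of_forall_eq 0 fun e => ?_
  obtain ⟨e', rfl⟩ := Ext.covariant_sequence_exact₃ X hS e rfl (Subsingleton.elim _ _)
  rw [Subsingleton.elim e' 0, Ext.zero_comp]

lemma subsingleton_contravariant₁ (Y : ModuleCat.{0} R) (i : ℕ)
    (h₂ : Subsingleton (Abelian.Ext S.X₂ Y i)) (h₃ : Subsingleton (Abelian.Ext S.X₃ Y (i + 1))) :
    Subsingleton (Abelian.Ext S.X₁ Y i) := by
  refine subsingleton_of_forall_eq 0 fun e => ?_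
  obtain ⟨e', rfl⟩ := Ext.contravariant_sequence_exact₁ hS Y e (add_comm 1 i)
    (Subsingleton.elim _ _)
  rw [Subsingleton.elim e' 0, Ext.comp_zero]

lemma subsingleton_contravariant₂ (Y : ModuleCat.{0} R) (i : ℕ)
    (h₁ : Subsingleton (Abelian.Ext S.X₁ Y i)) (h₃ : Subsingleton (Abelian.Ext S.X₃ Y i)) :
    Subsingleton (Abelian.Ext S.X₂ Y i) := by
  refine subsingleton_of_forall_eq 0 fun e => ?_
  obtain ⟨e', rfl⟩ := Ext.contravariant_sequence_exact₂ hS Y e (Subsingleton.elim _ _)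
  rw [Subsingleton.elim e' 0, Ext.comp_zero]

lemma subsingleton_contravariant₃ (Y : ModuleCat.{0} R) (i : ℕ)
    (h₁ : Subsingleton (Abelian.Ext S.X₁ Y i)) (h₂ : Subsingleton (Abelian.Ext S.X₂ Y (i + 1))) :
    Subsingleton (Abelian.Ext S.X₃ Y (i + 1)) := by
  refine subsingleton_of_forall_eq 0 fun e => ?_
  obtain ⟨e', rfl⟩ := Ext.contravariant_sequence_exact₃ hS Y e (Subsingleton.elim _ _)
    (add_comm 1 i)
  rw [Subsingleton.elim e' 0, Ext.comp_zero]

end LongExactSequences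

/-- The short complex of modules attached to an exact pair of linear maps. -/
abbrev shortComplex {M N P : ModuleCat.{0} R} (f : M →ₗ[R] N) (g : N →ₗ[R] P)
    (h : Function.Exact f g) : ShortComplex (ModuleCat.{0} R) :=
  ShortComplex.mk (ModuleCat.ofHom f) (ModuleCat.ofHom g) (by
    ext x; exact h.apply_apply_eq_zero x)

lemma shortExact_shortComplex {M N P : ModuleCat.{0} R} {f : M →ₗ[R] N} {g : N →ₗ[R] P}
    (h : Function.Exact f g) (hf : Function.Injective f) (hg : Function.Surjective g) :
    (shortComplex f g h).ShortExact where
  exact := (ShortComplex.ShortExact.moduleCat_exact_iff_function_exact _).mpr h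
  mono_f := (ModuleCat.mono_iff_injective _).mpr hf
  epi_g := (ModuleCat.epi_iff_surjective _).mpr hg

lemma subsingleton_ext_of_linearEquiv_left {M M' : ModuleCat.{0} R} (e : M ≃ₗ[R] M')
    (Y : ModuleCat.{0} R) (i : ℕ) (h : Subsingleton (Abelian.Ext M Y i)) :
    Subsingleton (Abelian.Ext M' Y i) := by
  refine subsingleton_of_forall_eq 0 fun a => ?_
  have : a = (Ext.mk₀ (ModuleCat.ofHom e.symm.toLinearMap)).comp
      ((Ext.mk₀ (ModuleCat.ofHom e.toLinearMap)).comp a (zero_add i)) (zero_add i) := by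
    rw [Ext.mk₀_comp_mk₀_assoc, ← ModuleCat.ofHom_comp]
    simp
  rw [this, Subsingleton.elim ((Ext.mk₀ (ModuleCat.ofHom e.toLinearMap)).comp a (zero_add i)) 0,
    Ext.comp_zero]

lemma subsingleton_ext_zero {M N : ModuleCat.{0} R} :
    Subsingleton (Abelian.Ext M N 0) ↔ Subsingleton (M →ₗ[R] N) :=
  (Ext.addEquiv₀.trans ModuleCat.homAddEquiv).subsingleton_congr

lemma subsingleton_ext_of_free (F : Type) [AddCommGroup F] [Module R F] [Module.Free R F]
    (Y : ModuleCat.{0} R) (i : ℕ) : Subsingleton (Abelian.Ext (ModuleCat.of R F) Y (i + 1)) :=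
  have : Projective (ModuleCat.of R F) := (IsProjective.iff_projective (R := R) F).mp inferInstance
  Ext.subsingleton_of_projective _ _ _

lemma subsingleton_ext_of_subsingleton {M : ModuleCat.{0} R} (hM : Subsingleton M)
    (Y : ModuleCat.{0} R) (i : ℕ) : Subsingleton (Abelian.Ext M Y i) :=
  subsingleton_of_forall_eq 0 fun a => by
    have h : 𝟙 M = 0 := (ModuleCat.isZero_of_subsingleton M).eq_of_src _ _
    rw [← Ext.mk₀_id_comp a, h, Ext.mk₀_zero, Ext.zero_comp]

/-- A finite module over a Noetherian ring has a finite free cover with finite kernel. -/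
lemma exists_free_cover [IsNoetherianRing R] (M : ModuleCat.{0} R) [Module.Finite R M] :
    ∃ (n : ℕ) (K : ModuleCat.{0} R) (_ : Module.Finite R K)
      (f : K →ₗ[R] ModuleCat.of R (Fin n → R)) (g : ModuleCat.of R (Fin n → R) →ₗ[R] M)
      (_ : Function.Injective f) (_ : Function.Surjective g), Function.Exact f g := by
  obtain ⟨n, g, hg⟩ := Module.Finite.exists_fin' R M
  exact ⟨n, ModuleCat.of R (LinearMap.ker g), inferInstanceAs (Module.Finite R (LinearMap.ker g)),
    (LinearMap.ker g).subtype, g, Subtype.val_injective, hg, LinearMap.exact_subtype_ker_map g⟩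

lemma finite_ext [IsNoetherianRing R] (Y : ModuleCat.{0} R) [Module.Finite R Y] (i : ℕ)
    (M : ModuleCat.{0} R) [Module.Finite R M] : Module.Finite R (Abelian.Ext M Y i) := by
  induction i generalizing M with
  | zero =>
    exact Module.Finite.equiv ((Ext.linearEquiv₀ (R := R)).trans
      (ModuleCat.homLinearEquiv (S := R))).symm
  | succ i ih =>
    obtain ⟨n, K, _, f, g, hf, hg, hfg⟩ := exists_free_cover M
    have hS := shortExact_shortComplex hfg hf hg
    have := ih K
    refine Module.Finite.of_surjective
      (Ext.precompOfLinear hS.extClass R Y (add_comm 1 i) : Abelian.Ext K Y i →ₗ[R] _) fun e => ?_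
    have := subsingleton_ext_of_free (Fin n → R) Y i
    exact Ext.contravariant_sequence_exact₃ hS Y e (Subsingleton.elim _ _) (add_comm 1 i)

lemma subsingleton_of_smul_surjective [IsLocalRing R] {E : Type*} [AddCommGroup E] [Module R E]
    [Module.Finite R E] {y : R} (hy : y ∈ IsLocalRing.maximalIdeal R)
    (h : ∀ e : E, ∃ e', y • e' = e) : Subsingleton E := by
  have hle : (⊤ : Submodule R E) ≤ Ideal.span {y} • ⊤ := fun e _ => by
    obtain ⟨e', rfl⟩ := h e
    exact Submodule.smul_mem_smul (Ideal.mem_span_singleton_self y) trivial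
  have := Submodule.eq_bot_of_le_smul_of_le_jacobson_bot _ _ Module.Finite.fg_top hle
    ((Ideal.span_singleton_le_iff_mem _).mpr
      ((IsLocalRing.jacobson_eq_maximalIdeal (⊥ : Ideal R) bot_ne_top).symm ▸ hy))
  exact (Submodule.subsingleton_iff R).mp (subsingleton_of_bot_eq_top this.symm)

lemma mk₀_smul_id_comp {M Y : ModuleCat.{0} R} {i : ℕ} (y : R) (e : Abelian.Ext M Y i) :
    (Ext.mk₀ (y • 𝟙 M)).comp e (zero_add i) = y • e := by
  rw [Ext.mk₀_smul, Ext.smul_comp, Ext.mk₀_id_comp]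

section SMul

variable {M : ModuleCat.{0} R} {y : R} (hy : IsSMulRegular M y)

include hy

lemma ext_smul_surjective (Y : ModuleCat.{0} R) (i : ℕ)
    (h : Subsingleton (Abelian.Ext (ModuleCat.of R (QuotSMulTop y M)) Y (i + 1)))
    (e : Abelian.Ext M Y i) : ∃ e' : Abelian.Ext M Y i, y • e' = e := by
  obtain ⟨e', he'⟩ := Ext.contravariant_sequence_exact₁ hy.smulShortComplex_shortExact Y e
    (add_comm 1 i) (@Subsingleton.elim _ h _ _)
  exact ⟨e', (mk₀_smul_id_comp y e').symm.trans he'⟩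

lemma ext_smul_injective (Y : ModuleCat.{0} R) (i : ℕ)
    (h : Subsingleton (Abelian.Ext (ModuleCat.of R (QuotSMulTop y M)) Y i))
    (e : Abelian.Ext M Y i) (he : y • e = 0) : e = 0 := by
  obtain ⟨e', rfl⟩ := Ext.contravariant_sequence_exact₂ hy.smulShortComplex_shortExact Y e
    ((mk₀_smul_id_comp y e).trans he)
  have h' : e' = 0 := @Subsingleton.elim _ h e' 0
  rw [h', Ext.comp_zero]
  rfl

lemma subsingleton_ext_of_quotSMulTop [IsNoetherianRing R] [IsLocalRing R] [Module.Finite R M]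
    (hym : y ∈ IsLocalRing.maximalIdeal R) (Y : ModuleCat.{0} R) [Module.Finite R Y] (i : ℕ)
    (h : Subsingleton (Abelian.Ext (ModuleCat.of R (QuotSMulTop y M)) Y (i + 1))) :
    Subsingleton (Abelian.Ext M Y i) :=
  have := finite_ext Y i M
  subsingleton_of_smul_surjective hym (ext_smul_surjective hy Y i h)

end SMul

lemma smul_ext_resField [IsLocalRing R] {y : R} (hy : y ∈ IsLocalRing.maximalIdeal R)
    (M : ModuleCat.{0} R) (i : ℕ) (e : Abelian.Ext (resField R) M i) : y • e = 0 := by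
  have h : y • 𝟙 (resField R) = 0 := by
    refine ModuleCat.hom_ext (LinearMap.ext fun a => ?_)
    change y • (a : IsLocalRing.ResidueField R) = 0
    rw [Algebra.smul_def, IsLocalRing.ResidueField.algebraMap_eq,
      (IsLocalRing.residue_eq_zero_iff y).mpr hy, zero_mul]
  rw [← mk₀_smul_id_comp, h, Ext.mk₀_zero, Ext.zero_comp]


lemma exists_lift_of_subsingleton_ext {X A B C : ModuleCat.{0} R} {f : A →ₗ[R] B} {g : B →ₗ[R] C}
    (h : Function.Exact f g) (hf : Function.Injective f) (hg : Function.Surjective g)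
    (hX : Subsingleton (Abelian.Ext X A 1)) (p : X →ₗ[R] C) : ∃ q : X →ₗ[R] B, g ∘ₗ q = p := by
  obtain ⟨a, ha⟩ := Ext.covariant_sequence_exact₃ X (shortExact_shortComplex h hf hg)
    (Ext.mk₀ (ModuleCat.ofHom p)) (zero_add 1) (@Subsingleton.elim _ hX _ _)
  obtain ⟨q, rfl⟩ := Ext.homEquiv₀.symm.surjective a
  refine ⟨q.hom, ?_⟩
  have h1 := (Ext.mk₀_comp_mk₀ q (ModuleCat.ofHom g)).symm.trans ha
  exact congrArg ModuleCat.Hom.hom (Ext.homEquiv₀.symm.injective h1)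

lemma exists_extend_of_subsingleton_ext {A B C Y : ModuleCat.{0} R} {f : A →ₗ[R] B}
    {g : B →ₗ[R] C} (h : Function.Exact f g) (hf : Function.Injective f)
    (hg : Function.Surjective g) (hY : Subsingleton (Abelian.Ext C Y 1)) (p : A →ₗ[R] Y) :
    ∃ q : B →ₗ[R] Y, q ∘ₗ f = p := by
  obtain ⟨a, ha⟩ := Ext.contravariant_sequence_exact₁ (shortExact_shortComplex h hf hg) Y
    (Ext.mk₀ (ModuleCat.ofHom p)) (add_zero 1) (@Subsingleton.elim _ hY _ _)
  obtain ⟨q, rfl⟩ := Ext.homEquiv₀.symm.surjective a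
  refine ⟨q.hom, ?_⟩
  have h1 := (Ext.mk₀_comp_mk₀ (ModuleCat.ofHom f) q).symm.trans ha
  exact congrArg ModuleCat.Hom.hom (Ext.homEquiv₀.symm.injective h1)

variable [IsLocalRing R]

/-- The modules `Ext^j(k, M)` vanish for `j < t`. -/
def DepthGE (t : ℕ) (M : ModuleCat.{0} R) : Prop :=
  ∀ j < t, Subsingleton (Abelian.Ext (resField R) M j)

lemma exists_isSMulRegular [IsNoetherianRing R] {M : ModuleCat.{0} R} [Module.Finite R M]
    (h : Subsingleton (Abelian.Ext (resField R) M 0)) :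
    ∃ y ∈ IsLocalRing.maximalIdeal R, IsSMulRegular M y := by
  have h' : Subsingleton (IsLocalRing.ResidueField R →ₗ[R] M) := subsingleton_ext_zero.mp h
  obtain ⟨y, hy, hreg⟩ := IsSMulRegular.subsingleton_linearMap_iff.mp h'
  refine ⟨y, ?_, hreg⟩
  have h1 := Module.mem_annihilator.mp hy (1 : IsLocalRing.ResidueField R)
  rwa [Algebra.smul_def, mul_one, IsLocalRing.ResidueField.algebraMap_eq,
    IsLocalRing.residue_eq_zero_iff] at h1

lemma DepthGE.quotSMulTop {t : ℕ} {M : ModuleCat.{0} R} (h : DepthGE (t + 1) M) {y : R}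
    (hy : IsSMulRegular M y) : DepthGE t (ModuleCat.of R (QuotSMulTop y M)) := fun j hj =>
  subsingleton_covariant₃ hy.smulShortComplex_shortExact _ j (h j (by omega))
    (h (j + 1) (by omega))

lemma DepthGE.succ {t : ℕ} {H Q : ModuleCat.{0} R} {y : R} (hy : y ∈ IsLocalRing.maximalIdeal R)
    {g : H →ₗ[R] Q} (hex : Function.Exact (y • (LinearMap.id : H →ₗ[R] H)) g)
    (hinj : Function.Injective (y • (LinearMap.id : H →ₗ[R] H))) (hg : Function.Surjective g)
    (hQ : DepthGE t Q) : DepthGE (t + 1) H := by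
  have hS := shortExact_shortComplex hex hinj hg
  intro j hj
  have key : ∀ e : Abelian.Ext (resField R) H j, e.comp
      (Ext.mk₀ (ModuleCat.ofHom (y • (LinearMap.id : H →ₗ[R] H)))) (add_zero j) = 0 := fun e => by
    have h1 := Ext.smul_eq_comp_mk₀ e y
    rw [smul_ext_resField hy] at h1
    exact h1.symm
  refine subsingleton_of_forall_eq 0 fun e => ?_
  cases j with
  | zero =>
    have := hS.mono_f
    refine Ext.postcomp_mk₀_injective_of_mono _ (shortComplex _ g hex).f ?_
    rw [map_zero]
    exact key e
  | succ j =>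
    have := hQ j (by omega)
    obtain ⟨e', rfl⟩ := Ext.covariant_sequence_exact₁ _ hS e (key e) rfl
    rw [@Subsingleton.elim _ this e' 0, Ext.zero_comp]

lemma DepthGE.linearMap {t : ℕ} [IsNoetherianRing R] {S W : ModuleCat.{0} R} [Module.Finite R W]
    (hS : ∀ i, Subsingleton (Abelian.Ext S W (i + 1))) (hW : DepthGE t W) :
    DepthGE t (ModuleCat.of R (S →ₗ[R] W)) := by
  induction t generalizing W with
  | zero => exact fun j hj => absurd hj (Nat.not_lt_zero j)
  | succ t ih =>
    obtain ⟨y, hym, hy⟩ := exists_isSMulRegular (hW 0 (Nat.succ_pos t))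
    have : Module.Finite R (ModuleCat.of R (QuotSMulTop y W)) :=
      inferInstanceAs (Module.Finite R (QuotSMulTop y W))
    have hd := ih (W := ModuleCat.of R (QuotSMulTop y W)) (fun i =>
      subsingleton_covariant₃ hy.smulShortComplex_shortExact _ _ (hS i) (hS (i + 1)))
      (hW.quotSMulTop hy)
    have hexW := LinearMap.exact_lsmul_mkQ_smul_top W y
    refine DepthGE.succ hym (g := LinearMap.compRight R
      (Submodule.mkQ (y • (⊤ : Submodule R W)))) (fun φ => ⟨fun h => ?_, ?_⟩) ?_ ?_ hd
    · have h1 : ∀ s, ∃ w, y • w = φ s := fun s => (hexW (φ s)).mp (LinearMap.congr_fun h s)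
      choose ψ hψ using h1
      refine ⟨⟨⟨ψ, fun a b => hy ?_⟩, fun r a => hy ?_⟩, LinearMap.ext hψ⟩
      · simp only [smul_add, hψ, map_add]
      · simp only [RingHom.id_apply]
        rw [smul_comm, hψ, hψ, map_smul]
    · rintro ⟨ψ, rfl⟩
      ext s
      exact (hexW (y • ψ s)).mpr ⟨ψ s, rfl⟩
    · intro a b hab
      ext s
      exact hy (LinearMap.congr_fun hab s)
    · intro φ
      exact exists_lift_of_subsingleton_ext (B := W) (C := ModuleCat.of R (QuotSMulTop y W))
        hexW hy (Submodule.mkQ_surjective _) (hS 0) φ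

lemma exists_injective_resField [IsNoetherianRing R] (Y : ModuleCat.{0} R) (t : ℕ) (s : ℕ)
    (N : ModuleCat.{0} R) [Module.Finite R N] (hN : DepthGE t N)
    (hN' : Nontrivial (Abelian.Ext (resField R) N t))
    (hY : ∀ i, s < i → Subsingleton (Abelian.Ext N Y i)) :
    ∃ (N' : ModuleCat.{0} R) (_ : Module.Finite R N') (f : resField R →ₗ[R] N'),
      Function.Injective f ∧ ∀ i, s + t < i → Subsingleton (Abelian.Ext N' Y i) := by
  induction t generalizing N s with
  | zero =>
    have : Nontrivial (resField R →ₗ[R] N) := by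
      rw [← not_subsingleton_iff_nontrivial] at hN' ⊢
      rwa [subsingleton_ext_zero] at hN'
    obtain ⟨f, hf⟩ := exists_ne (0 : resField R →ₗ[R] N)
    have : IsSimpleModule R (IsLocalRing.ResidueField R) :=
      isSimpleModule_iff_isCoatom.mpr (Ideal.isMaximal_def.mp
        (IsLocalRing.maximalIdeal.isMaximal R))
    exact ⟨N, inferInstance, f, (LinearMap.injective_or_eq_zero f).resolve_right hf, hY⟩
  | succ t ih =>
    obtain ⟨y, hym, hy⟩ := exists_isSMulRegular (hN 0 (Nat.succ_pos t))
    have : Module.Finite R (ModuleCat.of R (QuotSMulTop y N)) :=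
      inferInstanceAs (Module.Finite R (QuotSMulTop y N))
    have hnt : Nontrivial (Abelian.Ext (resField R) (ModuleCat.of R (QuotSMulTop y N)) t) := by
      rw [← not_subsingleton_iff_nontrivial] at hN' ⊢
      intro h
      refine hN' (subsingleton_of_forall_eq 0 fun e => ?_)
      obtain ⟨e', rfl⟩ := Ext.covariant_sequence_exact₁ _ hy.smulShortComplex_shortExact e
        ((Ext.smul_eq_comp_mk₀ e y).symm.trans (smul_ext_resField hym N _ e)) rfl
      have h' : e' = 0 := @Subsingleton.elim _ h e' 0
      rw [h', Ext.zero_comp]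
      rfl
    obtain ⟨N', h₁, f, h₂, h₃⟩ := ih (s + 1) (ModuleCat.of R (QuotSMulTop y N))
      (hN.quotSMulTop hy) hnt fun i hi => by
        obtain ⟨i, rfl⟩ : ∃ j, i = j + 1 := ⟨i - 1, by omega⟩
        exact subsingleton_contravariant₃ hy.smulShortComplex_shortExact Y i (hY i (by omega))
          (hY (i + 1) (by omega))
    exact ⟨N', h₁, f, h₂, fun i hi => h₃ i (by omega)⟩

/-- Over a Noetherian local ring of depth `d`, a finite module of finite injective dimension has
injective dimension at most `d` on finite modules. -/
lemma subsingleton_ext_of_finite_injDim [IsNoetherianRing R] {d : ℕ}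
    (hR : DepthGE d (ModuleCat.of R R))
    (hR' : Nontrivial (Abelian.Ext (resField R) (ModuleCat.of R R) d))
    (Y : ModuleCat.{0} R) [Module.Finite R Y] {n : ℕ}
    (hn : ∀ (N : ModuleCat.{0} R) (i : ℕ), n < i → Subsingleton (Abelian.Ext N Y i))
    (N : ModuleCat.{0} R) [Module.Finite R N] (i : ℕ) (hi : d < i) :
    Subsingleton (Abelian.Ext N Y i) := by
  have key : ∀ m i : ℕ, d < i → n < i + m → ∀ (N : Type) [AddCommGroup N] [Module R N],
      Module.Finite R N → Subsingleton (Abelian.Ext (ModuleCat.of R N) Y i) := by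
    intro m
    induction m with
    | zero => exact fun i _ hi N _ _ _ => hn _ i hi
    | succ m ih =>
      intro i hi him N _ _ _
      obtain ⟨N', _, f, hf, hN'⟩ := exists_injective_resField Y d 0 (ModuleCat.of R R) hR hR'
        (fun i hi => by
          obtain ⟨i, rfl⟩ : ∃ j, i = j + 1 := ⟨i - 1, by omega⟩
          exact subsingleton_ext_of_free R Y i)
      have hk : Subsingleton (Abelian.Ext (resField R) Y i) :=
        subsingleton_contravariant₁ (shortExact_shortComplex
          (P := ModuleCat.of R (N' ⧸ LinearMap.range f)) (LinearMap.exact_map_mkQ_range f) hf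
          (Submodule.mkQ_surjective _)) Y i (hN' i (by omega))
          (ih (i + 1) (by omega) (by omega) _ inferInstance)
      refine IsNoetherianRing.induction_on_isQuotientEquivQuotientPrime R
        (motive := fun N _ _ _ => Subsingleton (Abelian.Ext (ModuleCat.of R N) Y i)) ‹_›
        ?_ ?_ ?_
      · intro N _ _ _ _
        exact subsingleton_ext_of_subsingleton (M := ModuleCat.of R N) ‹_› Y i
      · intro N _ _ _ p e
        refine subsingleton_ext_of_linearEquiv_left (M := ModuleCat.of R (R ⧸ p.asIdeal))
          (M' := ModuleCat.of R N) e.symm Y i ?_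
        by_cases hp : p.asIdeal = IsLocalRing.maximalIdeal R
        · rw [hp]
          exact hk
        · obtain ⟨a, ha, hap⟩ := Set.exists_of_ssubset
            ((IsLocalRing.le_maximalIdeal p.isPrime.ne_top).lt_of_ne hp)
          have hreg : IsSMulRegular (ModuleCat.of R (R ⧸ p.asIdeal)) a := by
            intro u v huv
            obtain ⟨u, rfl⟩ := Ideal.Quotient.mk_surjective u
            obtain ⟨v, rfl⟩ := Ideal.Quotient.mk_surjective v
            have h1 : Ideal.Quotient.mk p.asIdeal (a * u) =
                Ideal.Quotient.mk p.asIdeal (a * v) := huv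
            rw [Ideal.Quotient.eq, ← mul_sub] at h1
            exact Ideal.Quotient.eq.mpr ((p.isPrime.mem_or_mem h1).resolve_left hap)
          have : Module.Finite R (ModuleCat.of R (R ⧸ p.asIdeal)) :=
            inferInstanceAs (Module.Finite R (R ⧸ p.asIdeal))
          exact subsingleton_ext_of_quotSMulTop hreg ha Y i (ih (i + 1) (by omega) (by omega)
            (QuotSMulTop a (R ⧸ p.asIdeal)) inferInstance)
      · intro N₁ _ _ _ N₂ _ _ _ N₃ _ _ _ f g hf hg hfg h₁ h₃
        exact subsingleton_contravariant₂ (shortExact_shortComplex (M := ModuleCat.of R N₁)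
          (N := ModuleCat.of R N₂) (P := ModuleCat.of R N₃) hfg hf hg) Y i h₁ h₃
  exact key (n + 1) i hi (by omega) N inferInstance

lemma subsingleton_ext_of_depthGE [IsNoetherianRing R] (Y : ModuleCat.{0} R) [Module.Finite R Y]
    (t s : ℕ) (hY : ∀ (N : ModuleCat.{0} R) [Module.Finite R N] (i : ℕ), s + t < i →
      Subsingleton (Abelian.Ext N Y i))
    (X : ModuleCat.{0} R) [Module.Finite R X] (hX : DepthGE t X) (i : ℕ) (hi : s < i) :
    Subsingleton (Abelian.Ext X Y i) := by
  induction t generalizing X s i with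
  | zero => exact hY X i hi
  | succ t ih =>
    obtain ⟨y, hym, hy⟩ := exists_isSMulRegular (hX 0 (Nat.succ_pos t))
    have : Module.Finite R (ModuleCat.of R (QuotSMulTop y X)) :=
      inferInstanceAs (Module.Finite R (QuotSMulTop y X))
    exact subsingleton_ext_of_quotSMulTop hy hym Y i (ih (s + 1)
      (fun N _ i hi => hY N i (by omega)) (ModuleCat.of R (QuotSMulTop y X))
      (hX.quotSMulTop hy) (i + 1) (by omega))


section Comparison

omit [IsLocalRing R]

variable {M : ModuleCat.{0} R} (P : ProjectiveResolution M) (N : ModuleCat.{0} R)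

lemma extMk_eq_zero_iff_prev (n : ℕ) (f : P.complex.X n ⟶ N)
    (hf : P.complex.d (n + 1) n ≫ f = 0) :
    P.extMk f (n + 1) rfl hf = 0 ↔
      ∃ g : P.complex.X ((ComplexShape.up ℕ).prev n) ⟶ N,
        P.complex.d n ((ComplexShape.up ℕ).prev n) ≫ g = f := by
  cases n with
  | succ n =>
    rw [CochainComplex.prev_nat_succ]
    exact P.extMk_eq_zero_iff f _ rfl hf n rfl
  | zero =>
    have h0 : P.complex.d 0 ((ComplexShape.up ℕ).prev 0) = 0 :=
      P.complex.shape _ _ (by simp)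
    simp only [h0, Limits.zero_comp, exists_const]
    rw [← P.extEquivCohomologyClass.apply_eq_iff_eq, P.extEquivCohomologyClass_extMk,
      P.extEquivCohomologyClass_zero, CochainComplex.HomComplex.CohomologyClass.mk_eq_zero_iff,
      CochainComplex.HomComplex.Cocycle.toSingleMk_mem_coboundaries_iff _ _ _ _ _ 1 (by simp)]
    have hz : P.cochainComplex.d (-((0 : ℕ) : ℤ)) 1 = 0 := by
      apply Limits.IsZero.eq_of_tgt
      exact HomologicalComplex.isZero_extend_X _ _ _ (fun i => by simp; omega)
    rw [hz]
    simp only [Limits.zero_comp, exists_const]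
    constructor
    · intro h
      rw [← cancel_epi (P.cochainComplexXIso (-((0 : ℕ) : ℤ)) 0 rfl).hom, ← h, Limits.comp_zero]
    · intro h
      rw [← h, Limits.comp_zero]

lemma smul_extMk (n : ℕ) (r : R) (f : P.complex.X n ⟶ N)
    (hf : P.complex.d (n + 1) n ≫ f = 0) :
    P.extMk (r • f) (n + 1) rfl (by rw [Linear.comp_smul, hf, smul_zero]) =
      r • P.extMk f (n + 1) rfl hf := by
  have h := P.extMk_comp_mk₀ f (n + 1) rfl hf (r • 𝟙 N)
  rw [Ext.mk₀_smul, Ext.comp_smul, Ext.comp_mk₀_id] at h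
  simp only [Linear.comp_smul, Category.comp_id] at h
  exact h.symm

lemma mem_ker_linearYonedaObj (n : ℕ) (f : P.complex.X n ⟶ N) :
    f ∈ LinearMap.ker (((P.complex.linearYonedaObj R N).sc n).g).hom ↔
      P.complex.d (n + 1) n ≫ f = 0 := by
  change P.complex.d ((ComplexShape.up ℕ).next n) n ≫ f = 0 ↔ _
  rw [CochainComplex.next]

/-- The linear map sending a cocycle to its class in `Ext`. -/
def cocycleToExt (n : ℕ) :
    LinearMap.ker (((P.complex.linearYonedaObj R N).sc n).g).hom →ₗ[R] Abelian.Ext M N n where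
  toFun f := P.extMk f.1 (n + 1) rfl ((mem_ker_linearYonedaObj P N n f.1).mp f.2)
  map_add' _ _ := (P.add_extMk _ _ _ _ _ _).symm
  map_smul' r f := smul_extMk P N n r f.1 ((mem_ker_linearYonedaObj P N n f.1).mp f.2)

/-- The two definitions of `Ext` agree. -/
def modExtEquiv (M N : ModuleCat.{0} R) (n : ℕ) : ModExt R n M N ≃ₗ[R] Abelian.Ext M N n :=
  let P := projectiveResolution M
  have hsurj : Function.Surjective (cocycleToExt P N n) := fun α => by
    obtain ⟨f, hf, rfl⟩ := P.extMk_surjective α (n + 1) rfl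
    exact ⟨⟨f, (mem_ker_linearYonedaObj P N n f).mpr hf⟩, rfl⟩
  have hker : LinearMap.range ((P.complex.linearYonedaObj R N).sc n).moduleCatToCycles =
      LinearMap.ker (cocycleToExt P N n) := by
    ext ⟨f, hf⟩
    rw [LinearMap.mem_ker]
    refine Iff.trans ?_ (extMk_eq_zero_iff_prev P N n f
      ((mem_ker_linearYonedaObj P N n f).mp hf)).symm
    exact ⟨fun ⟨g, hg⟩ => ⟨g, congrArg Subtype.val hg⟩, fun ⟨g, hg⟩ => ⟨g, Subtype.ext hg⟩⟩
  (P.isoExt n N).toLinearEquiv.trans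
    (((P.complex.linearYonedaObj R N).sc n).moduleCatHomologyIso.toLinearEquiv.trans
      ((Submodule.quotEquivOfEq _ _ hker).trans
        ((cocycleToExt P N n).quotKerEquivOfSurjective hsurj)))

end Comparison

section Duality

/-- An isomorphism in the first variable induces a linear equivalence on `Ext`. -/
def extEquivLeft {M M' : ModuleCat.{0} R} (e : M ≃ₗ[R] M') (Y : ModuleCat.{0} R) (i : ℕ) :
    Abelian.Ext M' Y i ≃ₗ[R] Abelian.Ext M Y i :=
  LinearEquiv.ofLinearMap
    (Ext.precompOfLinear (Ext.mk₀ (ModuleCat.ofHom e.toLinearMap)) R Y (zero_add i))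
    (Ext.precompOfLinear (Ext.mk₀ (ModuleCat.ofHom e.symm.toLinearMap)) R Y (zero_add i))
    (LinearMap.ext fun a => by
      change (Ext.mk₀ (ModuleCat.ofHom e.toLinearMap)).comp
        ((Ext.mk₀ (ModuleCat.ofHom e.symm.toLinearMap)).comp a (zero_add i)) (zero_add i) = a
      rw [Ext.mk₀_comp_mk₀_assoc, ← ModuleCat.ofHom_comp]
      simp)
    (LinearMap.ext fun a => by
      change (Ext.mk₀ (ModuleCat.ofHom e.symm.toLinearMap)).comp
        ((Ext.mk₀ (ModuleCat.ofHom e.toLinearMap)).comp a (zero_add i)) (zero_add i) = a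
      rw [Ext.mk₀_comp_mk₀_assoc, ← ModuleCat.ofHom_comp]
      simp)

variable {W : ModuleCat.{0} R} {d : ℕ}

omit [IsLocalRing R] in
lemma length_ext_eq_add {S : ShortComplex (ModuleCat.{0} R)} (hS : S.ShortExact)
    (Y : ModuleCat.{0} R) (i : ℕ)
    (h₁ : ∀ j, j + 1 = i → Subsingleton (Abelian.Ext S.X₁ Y j))
    (h₃ : Subsingleton (Abelian.Ext S.X₃ Y (i + 1))) :
    Module.length R (Abelian.Ext S.X₂ Y i) =
      Module.length R (Abelian.Ext S.X₃ Y i) + Module.length R (Abelian.Ext S.X₁ Y i) := by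
  refine Module.length_eq_add_of_exact
    (Ext.precompOfLinear (Ext.mk₀ S.g) R Y (zero_add i))
    (Ext.precompOfLinear (Ext.mk₀ S.f) R Y (zero_add i)) ?_ ?_ ?_
  · have := hS.epi_g
    rw [injective_iff_map_eq_zero]
    intro a ha
    cases i with
    | zero => exact Ext.precomp_mk₀_injective_of_epi Y S.g (ha.trans (map_zero _).symm)
    | succ i =>
      obtain ⟨b, rfl⟩ := Ext.contravariant_sequence_exact₃ hS Y a ha (add_comm 1 i)
      rw [@Subsingleton.elim _ (h₁ i rfl) b 0, Ext.comp_zero]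
  · exact fun a => Ext.contravariant_sequence_exact₁ hS Y a (add_comm 1 i)
      (Subsingleton.elim _ _)
  · refine fun a => ⟨fun ha => Ext.contravariant_sequence_exact₂ hS Y a ha, ?_⟩
    rintro ⟨b, rfl⟩
    change (Ext.mk₀ S.f).comp ((Ext.mk₀ S.g).comp b (zero_add i)) (zero_add i) = 0
    rw [Ext.mk₀_comp_mk₀_assoc, S.zero, Ext.mk₀_zero, Ext.zero_comp]

lemma length_ext_of_isFiniteLength
    (h0 : ∀ j, j ≠ d → Subsingleton (Abelian.Ext (resField R) W j))
    (e : Abelian.Ext (resField R) W d ≃ₗ[R] IsLocalRing.ResidueField R)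
    (M : Type) [AddCommGroup M] [Module R M] (hM : IsFiniteLength R M) :
    (∀ j, j ≠ d → Subsingleton (Abelian.Ext (ModuleCat.of R M) W j)) ∧
      Module.length R (Abelian.Ext (ModuleCat.of R M) W d) = Module.length R M := by
  induction hM with
  | @of_subsingleton M _ _ h =>
    have h' := fun j => subsingleton_ext_of_subsingleton (M := ModuleCat.of R M) h W j
    refine ⟨fun j _ => h' j, ?_⟩
    have := h' d
    rw [Module.length_eq_zero, Module.length_eq_zero]
  | @of_simple_quotient M _ _ N hs _ ih =>
    have hS := shortExact_shortComplex (M := ModuleCat.of R N) (N := ModuleCat.of R M)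
      (P := ModuleCat.of R (M ⧸ N)) (LinearMap.exact_subtype_mkQ N) N.subtype_injective
      N.mkQ_surjective
    obtain ⟨I, hI, ⟨u⟩⟩ := isSimpleModule_iff_quot_maximal.mp hs
    obtain rfl := IsLocalRing.eq_maximalIdeal hI
    have hQ : ∀ j, j ≠ d → Subsingleton (Abelian.Ext (ModuleCat.of R (M ⧸ N)) W j) :=
      fun j hj => subsingleton_ext_of_linearEquiv_left (M := resField R)
        (M' := ModuleCat.of R (M ⧸ N)) u.symm W j (h0 j hj)
    refine ⟨fun j hj => subsingleton_contravariant₂ hS W j (ih.1 j hj) (hQ j hj), ?_⟩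
    rw [length_ext_eq_add hS W d (fun j hj => ih.1 j (by omega)) (hQ (d + 1) (by omega))]
    refine (congrArg₂ _ (((extEquivLeft (M := ModuleCat.of R (M ⧸ N)) (M' := resField R)
      u W d).symm.trans (e.trans u.symm)).length_eq) ih.2).trans ?_
    rw [Module.length_eq_add_of_exact N.subtype N.mkQ N.subtype_injective N.mkQ_surjective
        (LinearMap.exact_subtype_mkQ N), add_comm]

omit [IsLocalRing R] in
lemma isFiniteLength_of_supportDim_le_zero [IsNoetherianRing R] (M : Type) [AddCommGroup M]
    [Module R M] [Module.Finite R M] (h : Module.supportDim R M ≤ 0) : IsFiniteLength R M := by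
  rw [Module.supportDim_eq_ringKrullDim_quotient_annihilator] at h
  have : Ring.KrullDimLE 0 (R ⧸ Module.annihilator R M) := Ring.krullDimLE_iff.mpr h
  have : IsArtinianRing (R ⧸ Module.annihilator R M) :=
    isArtinianRing_iff_krullDimLE_zero.mpr this
  let _ : Module (R ⧸ Module.annihilator R M) M := Module.quotientAnnihilator
  have : IsScalarTower R (R ⧸ Module.annihilator R M) M :=
    Module.IsTorsionBySet.isScalarTower _
  have : Module.Finite (R ⧸ Module.annihilator R M) M := Module.Finite.of_restrictScalars_finite R _ M
  have : IsArtinian R M := isArtinian_of_surjective_algebraMap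
    (R := R ⧸ Module.annihilator R M) Ideal.Quotient.mk_surjective
  exact isFiniteLength_iff_isNoetherian_isArtinian.mpr ⟨inferInstance, this⟩

omit [IsLocalRing R] in
lemma injective_of_length_eq {M N : Type} [AddCommGroup M] [Module R M] [AddCommGroup N]
    [Module R N] (hM : IsFiniteLength R M) (h : Module.length R N = Module.length R M)
    (f : M →ₗ[R] N) (hf : Function.Surjective f) : Function.Injective f := by
  rw [← LinearMap.ker_eq_bot, ← Submodule.subsingleton_iff_eq_bot, ← Module.length_eq_zero_iff (R := R)]
  have h1 := Module.length_eq_add_of_exact (LinearMap.ker f).subtype f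
    (LinearMap.ker f).subtype_injective hf (LinearMap.exact_subtype_ker_map f)
  rw [h] at h1
  have h2 := Module.length_ne_top_iff.mpr hM
  exact (ENat.add_left_injective_of_ne_top h2) ((zero_add _).trans h1).symm

/-- A form of local duality for Cohen-Macaulay modules of dimension `t`. -/
lemma injective_of_surjective_ext [IsNoetherianRing R] [Module.Finite R W]
    (h0 : ∀ j, j ≠ d → Subsingleton (Abelian.Ext (resField R) W j))
    (e : Abelian.Ext (resField R) W d ≃ₗ[R] IsLocalRing.ResidueField R)
    (t s : ℕ) (hd : s + t = d) (M : ModuleCat.{0} R) [Module.Finite R M] (hM : DepthGE t M)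
    (hMd : Module.supportDim R M ≤ t) :
    (∀ j, j ≠ s → Subsingleton (Abelian.Ext M W j)) ∧
      ∀ f : M →ₗ[R] Abelian.Ext M W s, Function.Surjective f → Function.Injective f := by
  induction t generalizing s M with
  | zero =>
    obtain rfl : s = d := hd
    have hfl := isFiniteLength_of_supportDim_le_zero M hMd
    obtain ⟨h1, h2⟩ := length_ext_of_isFiniteLength h0 e M hfl
    exact ⟨h1, injective_of_length_eq hfl h2⟩
  | succ t ih =>
    obtain ⟨y, hym, hy⟩ := exists_isSMulRegular (hM 0 (Nat.succ_pos t))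
    have : Module.Finite R (ModuleCat.of R (QuotSMulTop y M)) :=
      inferInstanceAs (Module.Finite R (QuotSMulTop y M))
    have hQd : Module.supportDim R (QuotSMulTop y M) ≤ t := by
      rw [← ENat.WithBot.add_le_add_one_right_iff,
        Module.supportDim_quotSMulTop_succ_eq_supportDim hy hym]
      exact_mod_cast hMd
    obtain ⟨h1, h2⟩ := ih (s + 1) (by omega) (ModuleCat.of R (QuotSMulTop y M))
      (hM.quotSMulTop hy) hQd
    have hv : ∀ j, j ≠ s → Subsingleton (Abelian.Ext M W j) := fun j hj =>
      subsingleton_ext_of_quotSMulTop hy hym W j (h1 (j + 1) (by omega))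
    refine ⟨hv, fun f hf => ?_⟩
    have hS := hy.smulShortComplex_shortExact
    let δ : Abelian.Ext M W s →ₗ[R] Abelian.Ext (ModuleCat.of R (QuotSMulTop y M)) W (s + 1) :=
      Ext.precompOfLinear hS.extClass R W (add_comm 1 s)
    have hδs : Function.Surjective δ := fun a =>
      Ext.contravariant_sequence_exact₃ hS W a (@Subsingleton.elim _ (hv (s + 1) (by omega)) _ _)
        (add_comm 1 s)
    have hδy : ∀ a, δ (y • a) = 0 := fun a =>
      (congrArg δ (mk₀_smul_id_comp y a).symm).trans (hS.extClass_comp_assoc a (h := add_comm 1 s))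
    have hle : y • (⊤ : Submodule R M) ≤ LinearMap.ker (δ ∘ₗ f) := by
      rintro _ ⟨m, -, rfl⟩
      change δ (f (y • m)) = 0
      rw [map_smul, hδy]
    have hinj := h2 (Submodule.liftQ _ (δ ∘ₗ f) hle) fun a => by
      obtain ⟨b, rfl⟩ := hδs a
      obtain ⟨m, rfl⟩ := hf b
      exact ⟨Submodule.Quotient.mk m, rfl⟩
    rw [← LinearMap.ker_eq_bot, ← Submodule.subsingleton_iff_eq_bot]
    refine subsingleton_of_smul_surjective hym fun ⟨m, hm⟩ => ?_
    have hm0 : (Submodule.Quotient.mk m : QuotSMulTop y M) = 0 := by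
      refine hinj (Eq.trans (b := 0) ?_ (map_zero _).symm)
      change δ (f m) = 0
      rw [LinearMap.mem_ker.mp hm, map_zero]
    obtain ⟨m', -, hm'⟩ := (Submodule.Quotient.mk_eq_zero _).mp hm0
    have hm'' : y • m' = m := hm'
    refine ⟨⟨m', ext_smul_injective hy W s (h1 s (by omega)) _ ?_⟩, Subtype.ext hm''⟩
    rw [← map_smul, hm'', LinearMap.mem_ker.mp hm]

end Duality

/-- Homological properties of a canonical module of a Cohen-Macaulay local ring of
dimension `d`. -/
structure IsDualizing (W : ModuleCat.{0} R) (d : ℕ) : Prop where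
  ringKrullDim_eq : ringKrullDim R = d
  depth_ring : DepthGE d (ModuleCat.of R R)
  finite : Module.Finite R W
  subsingleton_ext_resField : ∀ j, j ≠ d → Subsingleton (Abelian.Ext (resField R) W j)
  nonempty_equiv : Nonempty (Abelian.Ext (resField R) W d ≃ₗ[R] IsLocalRing.ResidueField R)
  subsingleton_ext_of_lt : ∀ (N : ModuleCat.{0} R) [Module.Finite R N] (i : ℕ), d < i →
    Subsingleton (Abelian.Ext N W i)

namespace IsDualizing

lemma depthGE {W : ModuleCat.{0} R} {d : ℕ} (h : IsDualizing W d) : DepthGE d W := fun j hj =>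
  h.subsingleton_ext_resField j hj.ne

lemma subsingleton_ext [IsNoetherianRing R] {W : ModuleCat.{0} R} {d : ℕ} (h : IsDualizing W d)
    (X : ModuleCat.{0} R) [Module.Finite R X] (hX : DepthGE d X) (i : ℕ) (hi : 0 < i) :
    Subsingleton (Abelian.Ext X W i) :=
  have := h.finite
  subsingleton_ext_of_depthGE W d 0
    (fun N _ i hi => h.subsingleton_ext_of_lt N i (by omega)) X hX i hi

variable [IsNoetherianRing R] {ω : Ideal R} {d : ℕ} (hω : IsDualizing (ModuleCat.of R ω) d) {x : R}
  (hxω : x ∈ ω) (hx : x ∈ nonZeroDivisors R) (hxm : x ∈ IsLocalRing.maximalIdeal R)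

include hω hxω hx hxm

lemma exists_surjective_ext :
    ∃ Φ : ω →ₗ[R] Abelian.Ext (qmod R ω (Ideal.span {x})) (ModuleCat.of R ω) 1,
      Function.Surjective Φ ∧ (∀ w : ω, Φ w = 0 ↔ w.1 ∈ Ideal.span {x}) ∧
        ∀ f : ω →ₗ[R] ω, Φ (f ⟨x, hxω⟩) = 0 := by
  have := hω.finite
  let x' : ω := ⟨x, hxω⟩
  let Q := qmod R ω (Ideal.span {x})
  let W := ModuleCat.of R ω
  let f : ModuleCat.of R R →ₗ[R] W := LinearMap.toSpanSingleton R ω x'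
  let g : W →ₗ[R] Q := Submodule.mkQ _
  have hf : Function.Injective f := fun a b hab => by
    have h1 : a * x = b * x := congrArg Subtype.val hab
    exact (mul_cancel_right_mem_nonZeroDivisors hx).mp h1
  have hg : Function.Surjective g := Submodule.mkQ_surjective _
  have hfg : Function.Exact f g := fun w => by
    refine (Submodule.Quotient.mk_eq_zero _).trans ?_
    refine Ideal.mem_span_singleton'.trans ?_
    exact ⟨fun ⟨a, ha⟩ => ⟨a, Subtype.ext ha⟩, fun ⟨a, ha⟩ => ⟨a, congrArg Subtype.val ha⟩⟩
  have hS := shortExact_shortComplex hfg hf hg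
  have hdim := ringKrullDim_quotient_span_singleton_succ_eq_ringKrullDim_of_mem_nonZeroDivisors
    hx hxm
  have hnt : Nontrivial (R ⧸ Ideal.span {x}) := Ideal.Quotient.nontrivial_iff.mpr fun h =>
    (IsLocalRing.maximalIdeal.isMaximal R).ne_top (top_le_iff.mp (h ▸
      (Ideal.span_singleton_le_iff_mem _).mpr hxm))
  obtain ⟨t, rfl⟩ : ∃ t, d = t + 1 := by
    refine ⟨d - 1, ?_⟩
    have h1 := ringKrullDim_nonneg_of_nontrivial (R := R ⧸ Ideal.span {x})
    have h2 : (0 : WithBot ℕ∞) + 1 ≤ d := by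
      rw [← hω.ringKrullDim_eq, ← hdim]
      gcongr
    have h3 : 1 ≤ d := by exact_mod_cast h2
    omega
  have hdim' : ringKrullDim (R ⧸ Ideal.span {x}) = t := by
    rw [hω.ringKrullDim_eq, Nat.cast_add, Nat.cast_one] at hdim
    exact ENat.WithBot.add_one_cancel.mp hdim
  have hQfin : Module.Finite R Q := Module.Finite.of_surjective g hg
  have hQdim : Module.supportDim R Q ≤ t := by
    rw [Module.supportDim_eq_ringKrullDim_quotient_annihilator, ← hdim']
    have hle : Ideal.span {x} ≤ Module.annihilator R Q := by
      rw [Ideal.span_singleton_le_iff_mem, Module.mem_annihilator]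
      intro q
      obtain ⟨w, rfl⟩ := hg q
      refine (Submodule.Quotient.mk_eq_zero _).mpr ?_
      exact Ideal.mem_span_singleton'.mpr ⟨w.1, mul_comm _ _⟩
    exact ringKrullDim_le_of_surjective (Ideal.Quotient.factor hle)
      (Ideal.Quotient.factor_surjective hle)
  have hQdepth : DepthGE t Q := fun j hj => subsingleton_covariant₃ hS _ j
    (hω.depthGE j (by omega)) (hω.depth_ring (j + 1) (by omega))
  obtain ⟨e⟩ := hω.nonempty_equiv
  let δ : Abelian.Ext (ModuleCat.of R R) W 0 →ₗ[R] Abelian.Ext Q W 1 :=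
    Ext.precompOfLinear hS.extClass R W (add_zero 1)
  let m : ω →ₗ[R] Abelian.Ext (ModuleCat.of R R) W 0 :=
    ((Ext.linearEquiv₀ (R := R) (X := ModuleCat.of R R) (Y := W)).symm.toLinearMap ∘ₗ
      (ModuleCat.homLinearEquiv (S := R) (M := ModuleCat.of R R) (N := W)).symm.toLinearMap) ∘ₗ
        (LinearMap.ringLmapEquivSelf R R ω).symm.toLinearMap
  have hm : ∀ w : ω, m w = Ext.mk₀ (ModuleCat.ofHom (LinearMap.toSpanSingleton R ω w)) := by
    intro w
    refine congrArg (fun l => Ext.mk₀ (ModuleCat.ofHom l)) ?_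
    ext
    simp
  have hms : Function.Surjective m :=
    ((Ext.linearEquiv₀ (R := R) (X := ModuleCat.of R R) (Y := W)).symm.surjective.comp
      (LinearEquiv.surjective _)).comp (LinearEquiv.surjective _)
  have hδ : Function.Surjective δ := fun a =>
    Ext.contravariant_sequence_exact₃ hS W a
      (@Subsingleton.elim _ (hω.subsingleton_ext W hω.depthGE 1 one_pos) _ _) (add_zero 1)
  have hΦs : Function.Surjective (δ ∘ₗ m) := hδ.comp hms
  have hΦf : ∀ h : ω →ₗ[R] ω, δ (m (h x')) = 0 := fun h => by
    have h1 : m (h x') = (Ext.mk₀ (ModuleCat.ofHom f)).comp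
        (Ext.mk₀ (ModuleCat.ofHom (h : W →ₗ[R] W))) (zero_add 0) := by
      rw [hm, Ext.mk₀_comp_mk₀, ← ModuleCat.ofHom_comp]
      congr 2
      ext
      simp [f]
    rw [h1]
    exact hS.extClass_comp_assoc _ (h := add_zero 1)
  have hle : Submodule.comap ω.subtype (Ideal.span {x}) ≤ LinearMap.ker (δ ∘ₗ m) := fun w hw => by
    obtain ⟨a, ha⟩ := Ideal.mem_span_singleton'.mp hw
    obtain rfl : a • x' = w := Subtype.ext ha
    exact ((δ ∘ₗ m).map_smul a x').trans ((congrArg (a • ·) (hΦf LinearMap.id)).trans (smul_zero a))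
  have hinj := (injective_of_surjective_ext hω.subsingleton_ext_resField e t 1 (by omega) Q
    hQdepth hQdim).2 (Submodule.liftQ _ (δ ∘ₗ m) hle) fun a => by
      obtain ⟨w, rfl⟩ := hΦs a
      exact ⟨Submodule.Quotient.mk w, rfl⟩
  refine ⟨δ ∘ₗ m, hΦs, fun w => ⟨fun hw => ?_, fun hw => hle hw⟩, hΦf⟩
  have h1 : (Submodule.Quotient.mk w : Q) = 0 :=
    hinj (Eq.trans (b := 0) hw (map_zero _).symm)
  exact (Submodule.Quotient.mk_eq_zero (Submodule.comap ω.subtype (Ideal.span {x}))).mp h1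

lemma nonempty_qmod_equiv_ext :
    Nonempty (qmod R ω (Ideal.span {x}) ≃ₗ[R]
      Abelian.Ext (qmod R ω (Ideal.span {x})) (ModuleCat.of R ω) 1) := by
  obtain ⟨Φ, h1, h2, -⟩ := exists_surjective_ext hω hxω hx hxm
  refine ⟨(Submodule.quotEquivOfEq _ _ ?_).trans (Φ.quotKerEquivOfSurjective h1)⟩
  ext w
  exact (h2 w).symm

/-- Every endomorphism of a canonical ideal is a homothety. -/
lemma exists_eq_mul (f : ω →ₗ[R] ω) : ∃ r : R, ∀ w : ω, f w = r • w := by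
  obtain ⟨Φ, -, h2, h3⟩ := exists_surjective_ext hω hxω hx hxm
  obtain ⟨r, hr⟩ := Ideal.mem_span_singleton'.mp ((h2 _).mp (h3 f))
  refine ⟨r, fun w => Subtype.ext ((mul_cancel_left_mem_nonZeroDivisors hx).mp ?_)⟩
  have h4 : x • f w = w.1 • f ⟨x, hxω⟩ := by
    rw [← map_smul, ← map_smul]
    exact congrArg f (Subtype.ext (mul_comm _ _))
  have h5 : x * (f w).1 = w.1 * (f ⟨x, hxω⟩).1 := congrArg Subtype.val h4
  rw [h5, ← hr]
  change w.1 * (r * x) = x * (r * w.1)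
  ring

end IsDualizing

omit [IsLocalRing R] in
lemma subsingleton_ext_pi {ι : Type} [Fintype ι] [DecidableEq ι] {X : ModuleCat.{0} R} {W : Type}
    [AddCommGroup W] [Module R W] (i : ℕ)
    (h : Subsingleton (Abelian.Ext X (ModuleCat.of R W) i)) :
    Subsingleton (Abelian.Ext X (ModuleCat.of R (ι → W)) i) := by
  refine subsingleton_of_forall_eq 0 fun e => ?_
  let p : ι → (ModuleCat.of R (ι → W) ⟶ ModuleCat.of R W) := fun k =>
    ModuleCat.ofHom (LinearMap.proj k)
  let s : ι → (ModuleCat.of R W ⟶ ModuleCat.of R (ι → W)) := fun k =>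
    ModuleCat.ofHom (LinearMap.single R (fun _ => W) k)
  have h1 : ∑ k, p k ≫ s k = 𝟙 (ModuleCat.of R (ι → W)) := by
    ext u k
    simp [p, s, ModuleCat.hom_sum, Finset.sum_apply, Pi.single_apply]
  have h2 : e = ∑ k, (e.comp (Ext.mk₀ (p k)) (add_zero i)).comp (Ext.mk₀ (s k)) (add_zero i) := by
    conv_lhs => rw [← Ext.comp_mk₀_id e, ← h1, Ext.mk₀_sum, Ext.comp_sum]
    refine Finset.sum_congr rfl fun k _ => ?_
    rw [Ext.comp_assoc_of_third_deg_zero, Ext.mk₀_comp_mk₀]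
  rw [h2]
  refine Finset.sum_eq_zero fun k _ => ?_
  rw [Subsingleton.elim (e.comp (Ext.mk₀ (p k)) (add_zero i)) 0, Ext.zero_comp]

omit [IsLocalRing R] in
lemma subsingleton_ext_prod {U V : Type} [AddCommGroup U] [Module R U] [AddCommGroup V]
    [Module R V] {Y : ModuleCat.{0} R} {i : ℕ}
    (hU : Subsingleton (Abelian.Ext (ModuleCat.of R U) Y i))
    (hV : Subsingleton (Abelian.Ext (ModuleCat.of R V) Y i)) :
    Subsingleton (Abelian.Ext (ModuleCat.of R (U × V)) Y i) :=
  subsingleton_contravariant₂ (shortExact_shortComplex (M := ModuleCat.of R U)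
    (N := ModuleCat.of R (U × V)) (P := ModuleCat.of R V) (f := LinearMap.inl R U V)
    (g := LinearMap.snd R U V) Function.Exact.inl_snd LinearMap.inl_injective
    LinearMap.snd_surjective) Y i hU hV

section Quotients

variable {U V W : Type} [AddCommGroup U] [Module R U] [AddCommGroup V] [Module R V]
  [AddCommGroup W] [Module R W]

omit [IsLocalRing R] in
/-- A linear equivalence matching two elements induces one between the quotients. -/
lemma nonempty_quotient_span_equiv (e : U ≃ₗ[R] V) (u : U) :
    Nonempty ((U ⧸ Submodule.span R {u}) ≃ₗ[R] (V ⧸ Submodule.span R {e u})) :=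
  ⟨Submodule.Quotient.equiv _ _ e (by
    rw [Submodule.map_span, Set.image_singleton]; rfl)⟩

omit [IsLocalRing R] in
lemma nonempty_quotient_prod_equiv (h : U →ₗ[R] V) (u : U) :
    Nonempty (((V × U) ⧸ Submodule.span R {(h u, u)}) ≃ₗ[R]
      V × (U ⧸ Submodule.span R {u})) := by
  let φ : V × U →ₗ[R] V × (U ⧸ Submodule.span R {u}) :=
    (LinearMap.fst R V U - h ∘ₗ LinearMap.snd R V U).prod
      ((Submodule.mkQ _) ∘ₗ LinearMap.snd R V U)
  have hφ : Function.Surjective φ := fun ⟨v, q⟩ => by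
    obtain ⟨u', rfl⟩ := Submodule.mkQ_surjective _ q
    exact ⟨(v + h u', u'), Prod.ext (add_sub_cancel_right _ _) rfl⟩
  have hk : Submodule.span R {(h u, u)} = LinearMap.ker φ := by
    ext ⟨v, u'⟩
    rw [Submodule.mem_span_singleton, LinearMap.mem_ker]
    constructor
    · rintro ⟨a, ha⟩
      obtain ⟨rfl, rfl⟩ := Prod.mk.inj ha
      refine Prod.ext ?_ ((Submodule.Quotient.mk_eq_zero _).mpr
        (Submodule.smul_mem _ a (Submodule.mem_span_singleton_self u)))
      change a • h u - h (a • u) = 0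
      rw [map_smul, sub_self]
    · intro h0
      obtain ⟨h1, h2⟩ := Prod.mk.inj h0
      obtain ⟨a, rfl⟩ := Submodule.mem_span_singleton.mp ((Submodule.Quotient.mk_eq_zero _).mp h2)
      refine ⟨a, Prod.ext ?_ rfl⟩
      have h3 : v = h (a • u) := sub_eq_zero.mp h1
      rw [h3, map_smul]
      rfl
  exact ⟨(Submodule.quotEquivOfEq _ _ hk).trans (φ.quotKerEquivOfSurjective hφ)⟩

omit [IsLocalRing R] in
lemma exact_quotient_prod (v : V) (u : U) :
    ∃ ρ : ((V × U) ⧸ Submodule.span R {(v, u)}) →ₗ[R] (V ⧸ Submodule.span R {v}),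
      Function.Surjective ρ ∧
        Function.Exact (Submodule.mkQ (Submodule.span R {(v, u)}) ∘ₗ LinearMap.inr R V U) ρ := by
  refine ⟨Submodule.mapQ _ _ (LinearMap.fst R V U) ?_, ?_, ?_⟩
  · rw [Submodule.span_singleton_le_iff_mem]
    exact Submodule.mem_span_singleton_self v
  · exact fun q => by
      obtain ⟨v', rfl⟩ := Submodule.mkQ_surjective _ q
      exact ⟨Submodule.Quotient.mk (v', 0), rfl⟩
  · intro q
    obtain ⟨⟨v', u'⟩, rfl⟩ := Submodule.mkQ_surjective _ q
    constructor
    · intro h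
      obtain ⟨a, rfl⟩ := Submodule.mem_span_singleton.mp ((Submodule.Quotient.mk_eq_zero _).mp h)
      refine ⟨u' - a • u, (Submodule.Quotient.eq _).mpr ?_⟩
      refine Submodule.mem_span_singleton.mpr ⟨-a, Prod.ext ?_ ?_⟩
      · simp
      · simp
    · rintro ⟨u'', h⟩
      rw [← h]
      exact (Submodule.Quotient.mk_eq_zero _).mpr (Submodule.zero_mem _)

omit [IsLocalRing R] in
lemma injective_mkQ_inr {v : V} (hv : ∀ a : R, a • v = 0 → a = 0) (u : U) :
    Function.Injective (Submodule.mkQ (Submodule.span R {(v, u)}) ∘ₗ LinearMap.inr R V U) := by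
  refine (injective_iff_map_eq_zero _).mpr fun u' h => ?_
  obtain ⟨a, ha⟩ := Submodule.mem_span_singleton.mp ((Submodule.Quotient.mk_eq_zero _).mp h)
  obtain ⟨h1, h2⟩ := Prod.mk.inj ha
  exact h2.symm.trans (by rw [hv a h1, zero_smul])

end Quotients

omit [IsLocalRing R] in
lemma subsingleton_ext_of_linearEquiv_right {M M' : ModuleCat.{0} R} (e : M ≃ₗ[R] M')
    (X : ModuleCat.{0} R) (i : ℕ) (h : Subsingleton (Abelian.Ext X M i)) :
    Subsingleton (Abelian.Ext X M' i) := by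
  refine subsingleton_of_forall_eq 0 fun a => ?_
  have h1 : a = (a.comp (Ext.mk₀ (ModuleCat.ofHom e.symm.toLinearMap)) (add_zero i)).comp
      (Ext.mk₀ (ModuleCat.ofHom e.toLinearMap)) (add_zero i) := by
    rw [Ext.comp_assoc_of_third_deg_zero, Ext.mk₀_comp_mk₀, ← ModuleCat.ofHom_comp]
    simp
  rw [h1, Subsingleton.elim (a.comp (Ext.mk₀ (ModuleCat.ofHom e.symm.toLinearMap)) (add_zero i)) 0,
    Ext.zero_comp]

lemma DepthGE.of_linearEquiv {M M' : ModuleCat.{0} R} {t : ℕ} (h : DepthGE t M)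
    (e : M ≃ₗ[R] M') : DepthGE t M' := fun j hj =>
  subsingleton_ext_of_linearEquiv_right e _ j (h j hj)

/-- A finite module over a local ring is generated by a given element together with a tuple
none of whose members is redundant modulo the maximal ideal. -/
lemma exists_minimal_tuple {W : Type} [AddCommGroup W] [Module R W] [Module.Finite R W] (u : W) :
    ∃ (n : ℕ) (w : Fin n → W), (∀ y : W, ∃ (r : R) (a : Fin n → R), r • u + ∑ i, a i • w i = y) ∧
      ∀ (r : R) (a : Fin n → R),
        r • u + ∑ i, a i • w i ∈ IsLocalRing.maximalIdeal R • (⊤ : Submodule R W) →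
          ∀ i, a i ∈ IsLocalRing.maximalIdeal R := by
  classical
  have hex : ∃ (n : ℕ) (w : Fin n → W),
      Submodule.span R {u} ⊔ Submodule.span R (Set.range w) = ⊤ := by
    obtain ⟨n, w, hw⟩ := Module.Finite.exists_fin (R := R) (M := W)
    exact ⟨n, w, by rw [hw, sup_top_eq]⟩
  obtain ⟨w, hw⟩ := Nat.find_spec hex
  have hmin := fun m => Nat.find_min (H := hex) (m := m)
  generalize Nat.find hex = n at w hw hmin
  refine ⟨n, w, fun y => ?_, fun r a ha i => ?_⟩
  · obtain ⟨y₁, h₁, y₂, h₂, rfl⟩ := Submodule.mem_sup.mp (hw ▸ Submodule.mem_top : y ∈ _)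
    obtain ⟨r, rfl⟩ := Submodule.mem_span_singleton.mp h₁
    obtain ⟨a, rfl⟩ := (Submodule.mem_span_range_iff_exists_fun R).mp h₂
    exact ⟨r, a, rfl⟩
  · by_contra hi
    obtain ⟨b, hb⟩ := (IsLocalRing.notMem_maximalIdeal.mp hi).exists_left_inv
    obtain ⟨m, rfl⟩ : ∃ m, n = m + 1 := ⟨n - 1, by have := i.pos; omega⟩
    refine hmin m (Nat.lt_succ_self m) ⟨w ∘ i.succAbove, ?_⟩
    set N := Submodule.span R {u} ⊔ Submodule.span R (Set.range (w ∘ i.succAbove)) with hN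
    have hu : u ∈ N := Submodule.mem_sup_left (Submodule.mem_span_singleton_self u)
    have hwj : ∀ j, w (i.succAbove j) ∈ N := fun j =>
      Submodule.mem_sup_right (Submodule.subset_span ⟨j, rfl⟩)
    refine top_le_iff.mp (Submodule.le_of_le_smul_of_le_jacobson_bot Module.Finite.fg_top
      (IsLocalRing.maximalIdeal_le_jacobson ⊥) ?_)
    rw [← hw]
    refine sup_le ((Submodule.span_singleton_le_iff_mem _ _).mpr (Submodule.mem_sup_left hu))
      (Submodule.span_le.mpr ?_)
    rintro _ ⟨j, rfl⟩
    rw [hw]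
    obtain rfl | ⟨j, rfl⟩ := i.eq_self_or_eq_succAbove j
    · have h1 : w j = b • (r • u + ∑ i, a i • w i) -
          b • (r • u + ∑ k, a (j.succAbove k) • w (j.succAbove k)) := by
        rw [Fin.sum_univ_succAbove _ j, ← smul_sub, add_sub_add_left_eq_sub, add_sub_cancel_right,
          smul_smul, hb, one_smul]
      rw [h1]
      refine Submodule.sub_mem _ (Submodule.mem_sup_right (Submodule.smul_mem _ _ ha))
        (Submodule.mem_sup_left (Submodule.smul_mem _ _ (Submodule.add_mem _
          (Submodule.smul_mem _ _ hu) (Submodule.sum_mem _ fun k _ =>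
            Submodule.smul_mem _ _ (hwj k)))))
    · exact Submodule.mem_sup_left (hwj j)

namespace IsDualizing

variable [IsNoetherianRing R] {ω : Ideal R} {d : ℕ} (hω : IsDualizing (ModuleCat.of R ω) d) {x : R}
  (hxω : x ∈ ω) (hx : x ∈ nonZeroDivisors R) (hxm : x ∈ IsLocalRing.maximalIdeal R)

include hω hxω hx hxm

/-- The quotient of `ω ^ n` by a generating tuple of the canonical ideal `ω` is
maximal Cohen-Macaulay: it is the canonical dual of the module of relations of the tuple. -/
lemma depthGE_quotient_span {n : ℕ} (w : Fin n → ω) (hw : ∀ y : ω, ∃ a : Fin n → R,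
    ∑ i, a i • w i = y) :
    DepthGE d (ModuleCat.of R ((Fin n → ω) ⧸ Submodule.span R {w})) := by
  have := hω.finite
  let W := ModuleCat.of R ω
  let g : ModuleCat.of R (Fin n → R) →ₗ[R] W := Fintype.linearCombination R w
  let S := ModuleCat.of R (LinearMap.ker g)
  let f : S →ₗ[R] ModuleCat.of R (Fin n → R) := (LinearMap.ker g).subtype
  have hf : Function.Injective f := Submodule.injective_subtype _
  have hg : Function.Surjective g := hw
  have hfg : Function.Exact f g := LinearMap.exact_subtype_ker_map g
  have hSE := shortExact_shortComplex hfg hf hg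
  have hS : ∀ i, Subsingleton (Abelian.Ext S W (i + 1)) := fun i =>
    subsingleton_contravariant₁ hSE W (i + 1) (subsingleton_ext_of_free (Fin n → R) W i)
      (hω.subsingleton_ext W hω.depthGE (i + 1 + 1) (Nat.succ_pos _))
  let Ψ : (Fin n → ω) →ₗ[R] S →ₗ[R] W :=
    (LinearMap.lcomp R ω f) ∘ₗ Fintype.bilinearCombination R R
  have hΨ : ∀ u s, Ψ u s = ∑ i, s.1 i • u i := fun _ _ => rfl
  have hΨs : Function.Surjective Ψ := fun p => by
    obtain ⟨q, hq⟩ := exists_extend_of_subsingleton_ext hfg hf hg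
      (hω.subsingleton_ext W hω.depthGE 1 one_pos) p
    refine ⟨fun i => q (Pi.single i 1), ?_⟩
    rw [← hq]
    refine LinearMap.ext fun s => (hΨ _ s).trans ?_
    have h1 := congrArg q (pi_eq_sum_univ' s.1)
    refine Eq.trans ?_ h1.symm
    rw [map_sum]
    refine Finset.sum_congr rfl fun i _ => ?_
    rw [← map_smul]
  have hk : Submodule.span R {w} = LinearMap.ker Ψ := by
    refine le_antisymm ((Submodule.span_singleton_le_iff_mem _ _).mpr
      (LinearMap.ext fun s => s.2)) fun u hu => ?_
    have hle : LinearMap.ker g ≤ LinearMap.ker (Fintype.linearCombination R u) := fun s hs =>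
      LinearMap.congr_fun (LinearMap.mem_ker.mp hu) ⟨s, hs⟩
    let c : ω →ₗ[R] ω := (LinearMap.ker g).liftQ _ hle ∘ₗ
      (g.quotKerEquivOfSurjective hg).symm.toLinearMap
    have hc : ∀ a, c (g a) = Fintype.linearCombination R u a := fun a =>
      (congrArg ((LinearMap.ker g).liftQ _ hle)
        ((g.quotKerEquivOfSurjective hg).symm_apply_apply (Submodule.Quotient.mk a))).trans rfl
    obtain ⟨r, hr⟩ := exists_eq_mul hω hxω hx hxm c
    refine Submodule.mem_span_singleton.mpr ⟨r, funext fun i => ?_⟩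
    have h1 := hc (Pi.single i 1)
    have h2 : g (Pi.single i 1) = w i := by
      simp [g]
    rw [h2, hr, Fintype.linearCombination_apply_single, one_smul] at h1
    exact h1
  exact (DepthGE.linearMap hS hω.depthGE).of_linearEquiv
    (M' := ModuleCat.of R ((Fin n → ω) ⧸ Submodule.span R {w}))
    ((Submodule.quotEquivOfEq _ _ hk).trans (Ψ.quotKerEquivOfSurjective hΨs)).symm

end IsDualizing

/-- An endomorphism of a finite power of `W` congruent to the identity modulo the maximal ideal
is bijective. -/
lemma bijective_id_add [IsNoetherianRing R] {W : Type} [AddCommGroup W] [Module R W]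
    [Module.Finite R W] {n : ℕ} (g : (Fin n → W) →ₗ[R] (Fin n → W)) (a : Fin n → Fin n → R)
    (ha : ∀ k l, a k l ∈ IsLocalRing.maximalIdeal R) (hg : ∀ u k, g u k = ∑ l, a k l • u l) :
    Function.Bijective (LinearMap.id + g : (Fin n → W) →ₗ[R] (Fin n → W)) := by
  have hs : Function.Surjective (LinearMap.id + g : (Fin n → W) →ₗ[R] (Fin n → W)) := by
    refine LinearMap.range_eq_top.mp (top_le_iff.mp (Submodule.le_of_le_smul_of_le_jacobson_bot
      Module.Finite.fg_top (IsLocalRing.maximalIdeal_le_jacobson ⊥) fun u _ => ?_))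
    have h1 : u = (LinearMap.id + g : (Fin n → W) →ₗ[R] (Fin n → W)) u - g u := by simp
    rw [h1]
    refine Submodule.sub_mem _ (Submodule.mem_sup_left ⟨u, rfl⟩) (Submodule.mem_sup_right ?_)
    have h2 : g u = ∑ k, ∑ l, a k l • (Pi.single k (u l) : Fin n → W) := by
      ext k
      simp [hg, Finset.sum_apply, Pi.single_apply]
    rw [h2]
    exact Submodule.sum_mem _ fun k _ => Submodule.sum_mem _ fun l _ =>
      Submodule.smul_mem_smul (ha k l) trivial
  exact ⟨IsNoetherian.injective_of_surjective_endomorphism _ hs, hs⟩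

omit [IsLocalRing R] in
lemma bijective_of_exact {A P Q : Type} [AddCommGroup A] [Module R A] [AddCommGroup P] [Module R P]
    [AddCommGroup Q] [Module R Q] {j : A →ₗ[R] P} {ρ : P →ₗ[R] Q} (hj : Function.Injective j)
    (h : Function.Exact j ρ) {φ : P →ₗ[R] P} {γ : A →ₗ[R] A} (hγ : Function.Bijective γ)
    (hφ : φ ∘ₗ j = j ∘ₗ γ) (hρ : ρ ∘ₗ φ = ρ) : Function.Bijective φ := by
  have h1 : ∀ u, φ (j u) = j (γ u) := LinearMap.congr_fun hφ
  have h2 : ∀ p, ρ (φ p) = ρ p := LinearMap.congr_fun hρ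
  constructor
  · refine (injective_iff_map_eq_zero _).mpr fun p hp => ?_
    obtain ⟨u, rfl⟩ := (h p).mp (by rw [← h2, hp, map_zero])
    rw [h1] at hp
    have h3 : γ u = 0 := hj (hp.trans (map_zero j).symm)
    rw [hγ.1 (h3.trans (map_zero γ).symm), map_zero]
  · intro p
    obtain ⟨u, hu⟩ := (h (p - φ p)).mp (by rw [map_sub, h2, sub_self])
    obtain ⟨u', rfl⟩ := hγ.2 u
    refine ⟨p + j u', ?_⟩
    rw [map_add, h1, hu, add_sub_cancel]

omit [IsLocalRing R] in
/-- A retraction of one extension of `M` onto another exhibits a common direct summand of the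
first one, unless it is an isomorphism. -/
lemma injective_of_retraction {Y X A P M : ModuleCat.{0} R} {i : Y →ₗ[R] X} {π : X →ₗ[R] M}
    {j : A →ₗ[R] P} {ρ : P →ₗ[R] M} (hi : Function.Injective i) (hiπ : Function.Exact i π)
    (hj : Function.Injective j) (hjρ : Function.Exact j ρ) {s : X →ₗ[R] P} {t : P →ₗ[R] X}
    (hs : ρ ∘ₗ s = π) (hst : s ∘ₗ t = LinearMap.id)
    (h : ¬ HasCommonSummandVia R i) : Function.Injective s := by
  have hs' : ∀ z, ρ (s z) = π z := LinearMap.congr_fun hs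
  have hst' : ∀ p, s (t p) = p := LinearMap.congr_fun hst
  by_contra hinj
  refine h ⟨ModuleCat.of R (LinearMap.ker s), A, P, ?_, ?_⟩
  · exact Submodule.nontrivial_iff_ne_bot.mpr fun hb => hinj (LinearMap.ker_eq_bot.mp hb)
  let f₁ : X →ₗ[R] LinearMap.ker s := LinearMap.codRestrict _ (LinearMap.id - t ∘ₗ s) fun z => by
    simp [hst']
  let f : X →ₗ[R] LinearMap.ker s × P := f₁.prod s
  have hf : Function.Bijective f := by
    constructor
    · refine (injective_iff_map_eq_zero _).mpr fun z hz => ?_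
      obtain ⟨h1, h2⟩ := Prod.mk.inj hz
      have h3 : z - t (s z) = 0 := congrArg Subtype.val h1
      have h4 : s z = 0 := h2
      rwa [h4, map_zero, sub_zero] at h3
    · rintro ⟨⟨z, hz⟩, p⟩
      have hz : s z = 0 := hz
      have h1 : s (z + t p) = p := by rw [map_add, hz, zero_add, hst']
      refine ⟨z + t p, Prod.ext (Subtype.ext ?_) h1⟩
      change z + t p - t (s (z + t p)) = z
      rw [h1, add_sub_cancel_right]
  have hmem : ∀ y, s (i y) ∈ LinearMap.range j := fun y =>
    (hjρ _).mp (by rw [hs', hiπ.apply_apply_eq_zero])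
  let e₂ : Y →ₗ[R] A := (LinearEquiv.ofInjective j hj).symm.toLinearMap ∘ₗ
    LinearMap.codRestrict (LinearMap.range j) (s ∘ₗ i) hmem
  have he₂ : ∀ y, j (e₂ y) = s (i y) := fun y =>
    congrArg Subtype.val ((LinearEquiv.ofInjective j hj).apply_symm_apply ⟨s (i y), hmem y⟩)
  let e : Y →ₗ[R] LinearMap.ker s × A := (f₁ ∘ₗ i).prod e₂
  have he : Function.Bijective e := by
    constructor
    · refine (injective_iff_map_eq_zero _).mpr fun y hy => ?_
      obtain ⟨h1, h2⟩ := Prod.mk.inj hy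
      refine hi (hf.1 ((Prod.ext h1 ?_).trans (map_zero (f ∘ₗ i)).symm))
      have h3 := he₂ y
      have h2 : e₂ y = 0 := h2
      rw [h2, map_zero] at h3
      exact h3.symm
    · rintro ⟨z, a⟩
      obtain ⟨z', hz'⟩ := hf.2 (z, j a)
      obtain ⟨h1, h2⟩ := Prod.mk.inj hz'
      have h2 : s z' = j a := h2
      obtain ⟨y, rfl⟩ := (hiπ z').mp (by rw [← hs', h2, hjρ.apply_apply_eq_zero])
      refine ⟨y, Prod.ext h1 (hj ?_)⟩
      exact (he₂ y).trans h2
  exact ⟨LinearEquiv.ofBijective e he, LinearEquiv.ofBijective f hf, j, fun y =>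
    Prod.ext rfl (he₂ y).symm⟩

/-- The middle term of an extension without common direct summand is determined by any other
extension `0 → W ^ n → P → M → 0` which is minimal in the sense that linear maps `P → W` are given
on `W ^ n` by coefficients in the maximal ideal. -/
lemma nonempty_equiv_of_minimal [IsNoetherianRing R] {Y X P M : ModuleCat.{0} R}
    {W : Type} [AddCommGroup W] [Module R W] [Module.Finite R W] {n : ℕ}
    {i : Y →ₗ[R] X} {π : X →ₗ[R] M} {j : ModuleCat.of R (Fin n → W) →ₗ[R] P} {ρ : P →ₗ[R] M}
    (hi : Function.Injective i) (hπ : Function.Surjective π) (hiπ : Function.Exact i π)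
    (hj : Function.Injective j) (hρ : Function.Surjective ρ) (hjρ : Function.Exact j ρ)
    (hPY : Subsingleton (Abelian.Ext P Y 1))
    (hXW : Subsingleton (Abelian.Ext X (ModuleCat.of R W) 1))
    (hmin : ∀ q : P →ₗ[R] W, ∃ a : Fin n → R, (∀ l, a l ∈ IsLocalRing.maximalIdeal R) ∧
      ∀ u : Fin n → W, q (j u) = ∑ l, a l • u l)
    (h : ¬ HasCommonSummandVia R i) : Nonempty (X ≃ₗ[R] P) := by
  obtain ⟨s, hs⟩ := exists_lift_of_subsingleton_ext hjρ hj hρ (subsingleton_ext_pi 1 hXW) π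
  obtain ⟨t, ht⟩ := exists_lift_of_subsingleton_ext hiπ hi hπ hPY ρ
  have hs' : ∀ z, ρ (s z) = π z := LinearMap.congr_fun hs
  have ht' : ∀ p, π (t p) = ρ p := LinearMap.congr_fun ht
  have hmem : ∀ p, (s ∘ₗ t - LinearMap.id : P →ₗ[R] P) p ∈ LinearMap.range j := fun p => (hjρ _).mp (by
    rw [LinearMap.sub_apply, map_sub, LinearMap.comp_apply, hs', ht', LinearMap.id_apply, sub_self])
  let g : P →ₗ[R] (Fin n → W) := (LinearEquiv.ofInjective j hj).symm.toLinearMap ∘ₗ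
    LinearMap.codRestrict (LinearMap.range j) (s ∘ₗ t - LinearMap.id) hmem
  have hg : ∀ p, j (g p) = s (t p) - p := fun p =>
    congrArg Subtype.val ((LinearEquiv.ofInjective j hj).apply_symm_apply ⟨_, hmem p⟩)
  choose a ha hga using fun k => hmin (LinearMap.proj k ∘ₗ g)
  have hst : Function.Bijective (s ∘ₗ t) := by
    refine bijective_of_exact hj hjρ (bijective_id_add (g ∘ₗ j) a ha fun u k => hga k u) ?_ ?_
    · refine LinearMap.ext fun u => ?_
      change s (t (j u)) = j (u + g (j u))
      rw [map_add, hg, add_sub_cancel]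
    · refine LinearMap.ext fun p => ?_
      change ρ (s (t p)) = ρ p
      rw [hs', ht']
  let θ := LinearEquiv.ofBijective (s ∘ₗ t) hst
  have hθ : ∀ p, θ p = s (t p) := fun _ => rfl
  have hinj := injective_of_retraction (s := θ.symm.toLinearMap ∘ₗ s) hi hiπ hj hjρ
    (LinearMap.ext fun z => by
      change ρ (θ.symm (s z)) = π z
      rw [← hs', ← θ.apply_symm_apply (s z), hθ, hs', ht', ← hθ, θ.apply_symm_apply])
    (LinearMap.ext fun p => θ.symm_apply_apply p) h
  have hinj' : Function.Injective s := fun z z' hz => hinj (congrArg θ.symm hz)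
  exact ⟨LinearEquiv.ofBijective s ⟨hinj', fun p => by
    obtain ⟨p', hp⟩ := hst.2 p
    exact ⟨t p', hp⟩⟩⟩

lemma coe_moduleDepth_eq {M : ModuleCat.{0} R} {d : ℕ}
    (h : (moduleDepth R M : WithBot ℕ∞) = (d : ℕ)) :
    DepthGE d M ∧ Nontrivial (Abelian.Ext (resField R) M d) := by
  have h' : moduleDepth R M = d := by exact_mod_cast h
  constructor
  · intro j hj
    by_contra hns
    have hnt : Nontrivial (Abelian.Ext (resField R) M j) := not_subsingleton_iff_nontrivial.mp hns
    have hle : moduleDepth R M ≤ j := sInf_le ⟨j, rfl, (modExtEquiv _ _ j).toEquiv.nontrivial⟩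
    rw [h'] at hle
    exact absurd hj (not_lt.mpr (by exact_mod_cast hle))
  · have hne : {n : ℕ∞ | ∃ m : ℕ, n = (m : ℕ∞) ∧
        Nontrivial (ModExt R m (ModuleCat.of R (IsLocalRing.ResidueField R)) M)}.Nonempty := by
      by_contra hemp
      rw [Set.not_nonempty_iff_eq_empty] at hemp
      have htop : moduleDepth R M = ⊤ := by rw [moduleDepth, hemp, sInf_empty]
      exact ENat.natCast_ne_top d (h'.symm.trans htop)
    obtain ⟨m, hm, hnt⟩ := csInf_mem hne
    obtain rfl : d = m := by exact_mod_cast h'.symm.trans hm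
    exact (modExtEquiv (resField R) M d).symm.toEquiv.nontrivial

omit [IsLocalRing R] in
lemma hasFiniteInjDim_iff {Y : ModuleCat.{0} R} : HasFiniteInjDim R Y ↔
    ∃ n : ℕ, ∀ (N : ModuleCat.{0} R) (i : ℕ), n < i → Subsingleton (Abelian.Ext N Y i) :=
  exists_congr fun _ => forall_congr' fun N => forall_congr' fun i => imp_congr_right fun _ =>
    (modExtEquiv N Y i).toEquiv.subsingleton_congr

lemma isDualizing_of_isCanonicalModule (hCM : IsCMLocalRing R) {W : ModuleCat.{0} R}
    (hW : IsCanonicalModule R W) : ∃ d, IsDualizing W d := by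
  have := hCM.1
  obtain ⟨hfin, hinj, d, hd, ⟨e⟩, hs⟩ := hW
  obtain ⟨hR, hR'⟩ := coe_moduleDepth_eq (hCM.2.trans hd)
  obtain ⟨n, hn⟩ := hasFiniteInjDim_iff.mp hinj
  exact ⟨d, {
    ringKrullDim_eq := hd
    depth_ring := hR
    finite := hfin
    subsingleton_ext_resField := fun j hj =>
      (modExtEquiv _ _ j).toEquiv.subsingleton_congr.mp (hs j hj)
    nonempty_equiv := ⟨(modExtEquiv _ _ d).symm.trans e⟩
    subsingleton_ext_of_lt := fun N _ i hi =>
      subsingleton_ext_of_finite_injDim hR hR' W hn N i hi }⟩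

lemma subsingleton_ext_of_hasFiniteInjDim (hCM : IsCMLocalRing R) {d : ℕ}
    (hd : ringKrullDim R = (d : ℕ)) (Y : ModuleCat.{0} R) [Module.Finite R Y]
    (hY : HasFiniteInjDim R Y) (X : ModuleCat.{0} R) [Module.Finite R X] (hX : DepthGE d X) :
    Subsingleton (Abelian.Ext X Y 1) := by
  have := hCM.1
  obtain ⟨hR, hR'⟩ := coe_moduleDepth_eq (hCM.2.trans hd)
  obtain ⟨n, hn⟩ := hasFiniteInjDim_iff.mp hY
  exact subsingleton_ext_of_depthGE Y d 0 (fun N _ i hi =>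
    subsingleton_ext_of_finite_injDim hR hR' Y hn N i (by omega)) X hX 1 one_pos

lemma mem_maximalIdeal_of_not_isGorensteinLocalRing (hCM : IsCMLocalRing R)
    (hnG : ¬ IsGorensteinLocalRing R) {ω : Ideal R} (hω : IsCanonicalIdeal R ω) {x : R}
    (hxω : x ∈ ω) : x ∈ IsLocalRing.maximalIdeal R := by
  by_contra hx
  obtain rfl : ω = ⊤ := Ideal.eq_top_of_isUnit_mem _ hxω (IsLocalRing.notMem_maximalIdeal.mp hx)
  obtain ⟨n, hn⟩ := hasFiniteInjDim_iff.mp hω.2.1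
  exact hnG ⟨hCM.1, inferInstance, hasFiniteInjDim_iff.mpr ⟨n, fun N i hi =>
    subsingleton_ext_of_linearEquiv_right (M := ModuleCat.of R (⊤ : Ideal R))
      (M' := ModuleCat.of R R) Submodule.topEquiv N i (hn N i hi)⟩⟩

namespace IsDualizing

variable [IsNoetherianRing R] {ω : Ideal R} {d : ℕ} (hω : IsDualizing (ModuleCat.of R ω) d) {x : R}
  (hxω : x ∈ ω) (hx : x ∈ nonZeroDivisors R) (hxm : x ∈ IsLocalRing.maximalIdeal R)

include hω hxω hx hxm

/-- The middle term of a minimal maximal Cohen-Macaulay approximation of `V / R v` is the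
pushout of `V` and `ω ^ n` over `R`, for a suitable tuple `w` of elements of `ω`. -/
lemma nonempty_equiv_quotient_span_prod {V : Type} [AddCommGroup V] [Module R V] {v : V}
    (hv : ∀ r : R, r • v = 0 → r = 0) {n : ℕ} (w : Fin n → ω)
    (hmin : ∀ (c : V →ₗ[R] ω) (a : Fin n → R), c v + ∑ l, a l • w l = 0 →
      ∀ l, a l ∈ IsLocalRing.maximalIdeal R)
    {M Y X : ModuleCat.{0} R} {i : Y →ₗ[R] X} {π : X →ₗ[R] M} (h : IsMinMCMApprox R M Y X i π)
    (e : M ≃ₗ[R] V ⧸ Submodule.span R {v})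
    (hPY : Subsingleton (Abelian.Ext
      (ModuleCat.of R ((V × (Fin n → ω)) ⧸ Submodule.span R {(v, w)})) Y 1)) :
    Nonempty (X ≃ₗ[R] ((V × (Fin n → ω)) ⧸ Submodule.span R {(v, w)})) := by
  obtain ⟨⟨-, -, ⟨hXf, hXd⟩, -, hi, hπ, hiπ⟩, hnc⟩ := h
  have := hω.finite
  have hXd := (coe_moduleDepth_eq (hXd.trans hω.ringKrullDim_eq)).1
  obtain ⟨ρ, hρ, hex⟩ := exact_quotient_prod (R := R) v w
  have hj := injective_mkQ_inr hv w
  refine nonempty_equiv_of_minimal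
    (P := ModuleCat.of R ((V × (Fin n → ω)) ⧸ Submodule.span R {(v, w)}))
    (ρ := e.symm.toLinearMap ∘ₗ ρ) hi hπ hiπ hj (e.symm.surjective.comp hρ)
    (fun p => (map_eq_zero_iff e.symm e.symm.injective).trans (hex p)) hPY
    (hω.subsingleton_ext X hXd 1 one_pos) (fun q => ?_) hnc
  let q' : V × (Fin n → ω) →ₗ[R] ω := q ∘ₗ Submodule.mkQ _
  choose a ha using fun l => exists_eq_mul hω hxω hx hxm
    (q' ∘ₗ LinearMap.inr R V _ ∘ₗ LinearMap.single R (fun _ => ω) l)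
  have hq : ∀ u : Fin n → ω, q' (0, u) = ∑ l, a l • u l := fun u => by
    have h1 : q' (0, u) = (q' ∘ₗ LinearMap.inr R V _) (∑ l, Pi.single l (u l)) := by
      rw [Finset.univ_sum_single]
      rfl
    rw [h1, map_sum]
    exact Finset.sum_congr rfl fun l _ => ha l (u l)
  refine ⟨a, hmin (q' ∘ₗ LinearMap.inl R V _) a ?_, hq⟩
  rw [← hq]
  change q' (v, 0) + q' (0, w) = 0
  rw [← map_add]
  change q (Submodule.Quotient.mk _) = 0
  rw [Prod.mk_add_mk, add_zero, zero_add, (Submodule.Quotient.mk_eq_zero _).mpr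
    (Submodule.mem_span_singleton_self _), map_zero]

end IsDualizing

section MinimalApproximations

variable [IsNoetherianRing R] {ω : Ideal R} {d : ℕ} (hCM : IsCMLocalRing R)
  (hω : IsDualizing (ModuleCat.of R ω) d) {x : R} (hxω : x ∈ ω) (hx : x ∈ nonZeroDivisors R)
  (hxm : x ∈ IsLocalRing.maximalIdeal R)

include hCM hω hxω hx hxm

lemma nonempty_equiv_of_minApprox_ext {n : ℕ} {w : Fin n → ω}
    (hgen : ∀ y : ω, ∃ (r : R) (a : Fin n → R), r • ⟨x, hxω⟩ + ∑ i, a i • w i = y)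
    (hmin : ∀ (r : R) (a : Fin n → R),
      r • ⟨x, hxω⟩ + ∑ i, a i • w i ∈ IsLocalRing.maximalIdeal R • (⊤ : Submodule R ω) →
        ∀ i, a i ∈ IsLocalRing.maximalIdeal R)
    {Y X : ModuleCat.{0} R} {i : Y →ₗ[R] X}
    {π : X →ₗ[R] ModExt R 1 (qmod R ω (Ideal.span {x})) (ModuleCat.of R ↥ω)}
    (h : IsMinMCMApprox R (ModExt R 1 (qmod R ω (Ideal.span {x})) (ModuleCat.of R ↥ω)) Y X i π) :
    Nonempty (X ≃ₗ[R] ((ω × (Fin n → ω)) ⧸ Submodule.span R {((⟨x, hxω⟩ : ω), w)})) := by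
  have : Module.Finite R ω := hω.finite
  have := h.1.2.1
  obtain ⟨e⟩ := hω.nonempty_qmod_equiv_ext hxω hx hxm
  have hspan : Submodule.comap ω.subtype (Ideal.span {x}) =
      Submodule.span R {(⟨x, hxω⟩ : ω)} := by
    ext y
    rw [Submodule.mem_comap, Submodule.mem_span_singleton, Submodule.mem_span_singleton]
    exact ⟨fun ⟨a, ha⟩ => ⟨a, Subtype.ext ha⟩, fun ⟨a, ha⟩ => ⟨a, congrArg Subtype.val ha⟩⟩
  obtain ⟨c⟩ := nonempty_quotient_span_equiv
      (Fin.consLinearEquiv R (fun _ : Fin (n + 1) => ω))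
    ((⟨x, hxω⟩ : ω), w)
  refine hω.nonempty_equiv_quotient_span_prod hxω hx hxm
    (fun r hr => (mul_right_mem_nonZeroDivisors_eq_zero_iff hx).mp (congrArg Subtype.val hr)) w
    (fun f a hfa => ?_) h (((modExtEquiv _ _ 1).trans e.symm).trans
      (Submodule.quotEquivOfEq _ _ hspan))
    (subsingleton_ext_of_linearEquiv_left (M := ModuleCat.of R ((Fin (n + 1) → ω) ⧸
      Submodule.span R {Fin.consLinearEquiv R (fun _ : Fin (n + 1) => ω) ((⟨x, hxω⟩ : ω), w)})) c.symm _ 1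
      (subsingleton_ext_of_hasFiniteInjDim hCM hω.ringKrullDim_eq Y h.1.2.2.2.1 _
        (hω.depthGE_quotient_span hxω hx hxm _ fun y => ?_)))
  · obtain ⟨r, hr⟩ := hω.exists_eq_mul hxω hx hxm f
    refine hmin r a ?_
    rw [← hr, hfa]
    exact Submodule.zero_mem _
  · obtain ⟨r, a, rfl⟩ := hgen y
    refine ⟨Fin.cons r a, ?_⟩
    rw [Fin.sum_univ_succ]
    rfl

lemma nonempty_equiv_of_minApprox_quotient {n : ℕ} {w : Fin n → ω}
    (hgen : ∀ y : ω, ∃ a : Fin n → R, ∑ i, a i • w i = y)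
    (hmin : ∀ a : Fin n → R,
      ∑ i, a i • w i ∈ IsLocalRing.maximalIdeal R • (⊤ : Submodule R ω) →
        ∀ i, a i ∈ IsLocalRing.maximalIdeal R)
    {Y X : ModuleCat.{0} R} {i : Y →ₗ[R] X} {π : X →ₗ[R] ModuleCat.of R (R ⧸ Ideal.span {x})}
    (h : IsMinMCMApprox R (ModuleCat.of R (R ⧸ Ideal.span {x})) Y X i π) :
    Nonempty (X ≃ₗ[R] R × ((Fin n → ω) ⧸ Submodule.span R {w})) := by
  have : Module.Finite R ω := hω.finite
  have := h.1.2.1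
  obtain ⟨b, hb⟩ := hgen ⟨x, hxω⟩
  let f : (Fin n → ω) →ₗ[R] R := ω.subtype ∘ₗ ∑ i, b i • LinearMap.proj i
  have hf : f w = x := by
    simpa [f] using congrArg Subtype.val hb
  obtain ⟨c⟩ := nonempty_quotient_prod_equiv f w
  rw [hf] at c
  have hC : Subsingleton (Abelian.Ext
      (ModuleCat.of R (R × ((Fin n → ω) ⧸ Submodule.span R {w}))) Y 1) :=
    subsingleton_ext_prod (subsingleton_ext_of_free R Y 0)
      (subsingleton_ext_of_hasFiniteInjDim hCM hω.ringKrullDim_eq Y h.1.2.2.2.1 _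
        (hω.depthGE_quotient_span hxω hx hxm w hgen))
  have hmin' : ∀ (g : R →ₗ[R] ω) (a : Fin n → R), g x + ∑ l, a l • w l = 0 →
      ∀ l, a l ∈ IsLocalRing.maximalIdeal R := fun g a hga => hmin a (by
    rw [← neg_eq_of_add_eq_zero_right hga, ← mul_one x, ← smul_eq_mul, map_smul]
    exact Submodule.neg_mem _ (Submodule.smul_mem_smul hxm Submodule.mem_top))
  obtain ⟨e⟩ := hω.nonempty_equiv_quotient_span_prod hxω hx hxm (v := x)
    (fun r hr => (mul_right_mem_nonZeroDivisors_eq_zero_iff hx).mp hr) w hmin' h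
    (LinearEquiv.refl R _) (subsingleton_ext_of_linearEquiv_left
      (M := ModuleCat.of R (R × ((Fin n → ω) ⧸ Submodule.span R {w}))) c.symm _ 1 hC)
  exact ⟨e.trans c⟩

lemma nonempty_equiv_or_nonempty_equiv {Y₁ X₁ Y₂ X₂ : ModuleCat.{0} R} {i₁ : Y₁ →ₗ[R] X₁}
    {π₁ : X₁ →ₗ[R] ModExt R 1 (qmod R ω (Ideal.span {x})) (ModuleCat.of R ↥ω)}
    (h₁ : IsMinMCMApprox R (ModExt R 1 (qmod R ω (Ideal.span {x})) (ModuleCat.of R ↥ω)) Y₁ X₁ i₁ π₁)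
    {i₂ : Y₂ →ₗ[R] X₂} {π₂ : X₂ →ₗ[R] ModuleCat.of R (R ⧸ Ideal.span {x})}
    (h₂ : IsMinMCMApprox R (ModuleCat.of R (R ⧸ Ideal.span {x})) Y₂ X₂ i₂ π₂) :
    Nonempty ((R × X₁) ≃ₗ[R] X₂) ∨ Nonempty ((R × X₁) ≃ₗ[R] (ω × X₂)) := by
  have : Module.Finite R ω := hω.finite
  obtain ⟨n, w, hgen, hmin⟩ := exists_minimal_tuple (R := R) (⟨x, hxω⟩ : ω)
  obtain ⟨e₁⟩ := nonempty_equiv_of_minApprox_ext hCM hω hxω hx hxm hgen hmin h₁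
  by_cases hxω' : (⟨x, hxω⟩ : ω) ∈ IsLocalRing.maximalIdeal R • (⊤ : Submodule R ω)
  · right
    have hgen' : ∀ y : ω, ∃ a : Fin n → R, ∑ i, a i • w i = y := by
      have hle : (⊤ : Submodule R ω) ≤ Submodule.span R (Set.range w) :=
        Submodule.le_of_le_smul_of_le_jacobson_bot Module.Finite.fg_top
          (IsLocalRing.maximalIdeal_le_jacobson ⊥) fun y _ => by
            obtain ⟨r, a, rfl⟩ := hgen y
            rw [add_comm]
            exact Submodule.add_mem_sup
              ((Submodule.mem_span_range_iff_exists_fun R).mpr ⟨a, rfl⟩)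
              (Submodule.smul_mem _ r hxω')
      exact fun y => (Submodule.mem_span_range_iff_exists_fun R).mp (hle trivial)
    obtain ⟨e₂⟩ := nonempty_equiv_of_minApprox_quotient hCM hω hxω hx hxm hgen'
      (fun a ha => hmin 0 a (by rwa [zero_smul, zero_add])) h₂
    obtain ⟨b, hb⟩ := hgen' ⟨x, hxω⟩
    let f : (Fin n → ω) →ₗ[R] ω := ∑ i, b i • LinearMap.proj i
    have hf : f w = ⟨x, hxω⟩ := by
      simpa [f] using hb
    obtain ⟨c⟩ := nonempty_quotient_prod_equiv f w
    rw [hf] at c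
    let C := (Fin n → ω) ⧸ Submodule.span R {w}
    let σ : (R × ω × C) ≃ₗ[R] (ω × R × C) :=
      (LinearEquiv.prodAssoc R R ω C).symm.trans
        (((LinearEquiv.prodComm R R ω).prodCongr (LinearEquiv.refl R C)).trans
          (LinearEquiv.prodAssoc R ω R C))
    exact ⟨((LinearEquiv.refl R R).prodCongr (e₁.trans c)).trans
      (σ.trans ((LinearEquiv.refl R ω).prodCongr e₂.symm))⟩
  · left
    obtain ⟨e₂⟩ := nonempty_equiv_of_minApprox_quotient hCM hω hxω hx hxm
      (w := Fin.consLinearEquiv R (fun _ : Fin (n + 1) => ω) ((⟨x, hxω⟩ : ω), w))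
      (fun y => by
        obtain ⟨r, a, rfl⟩ := hgen y
        refine ⟨Fin.cons r a, ?_⟩
        rw [Fin.sum_univ_succ]
        rfl)
      (fun a ha => by
        rw [Fin.sum_univ_succ] at ha
        have ha' : a 0 • (⟨x, hxω⟩ : ω) + ∑ i : Fin n, a i.succ • w i ∈
          IsLocalRing.maximalIdeal R • (⊤ : Submodule R ω) := ha
        have h3 := hmin _ _ ha'
        refine Fin.cases ?_ h3
        by_contra h0
        refine hxω' ((Submodule.smul_mem_iff_of_isUnit _ (IsLocalRing.notMem_maximalIdeal.mp h0)).mp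
          ((Submodule.add_mem_iff_left _ (Submodule.sum_mem _ fun k _ =>
            Submodule.smul_mem_smul (h3 k) Submodule.mem_top)).mp ha'))) h₂
    obtain ⟨c⟩ := nonempty_quotient_span_equiv
      (Fin.consLinearEquiv R (fun _ : Fin (n + 1) => ω))
      ((⟨x, hxω⟩ : ω), w)
    exact ⟨((LinearEquiv.refl R R).prodCongr (e₁.trans c)).trans e₂.symm⟩

end MinimalApproximations

end ExtTools

theorem stmt1 (R : Type) [CommRing R] [IsLocalRing R]
    (hCM : IsCMLocalRing R) (hGG : IsGenericallyGorenstein R)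
    (hnG : ¬ IsGorensteinLocalRing R)
    (ω : Ideal R) (hω : IsCanonicalIdeal R ω)
    (x : R) (hxω : x ∈ ω) (hxreg : x ∈ nonZeroDivisors R)
    (Y₁ X₁ : ModuleCat R) (ι₁ : Y₁ →ₗ[R] X₁) (π₁ : X₁ →ₗ[R] ModExt R 1 (qmod R ω (Ideal.span {x})) (ModuleCat.of R ↥ω))
    (h₁ : IsMinMCMApprox R (ModExt R 1 (qmod R ω (Ideal.span {x})) (ModuleCat.of R ↥ω)) Y₁ X₁ ι₁ π₁)
    (Y₂ X₂ : ModuleCat R) (ι₂ : Y₂ →ₗ[R] X₂) (π₂ : X₂ →ₗ[R] ModuleCat.of R (R ⧸ Ideal.span {x}))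
    (h₂ : IsMinMCMApprox R (ModuleCat.of R (R ⧸ Ideal.span {x})) Y₂ X₂ ι₂ π₂) :
    ((Nonempty ((R × X₁) ≃ₗ[R] X₂)) ∨ (Nonempty ((R × X₁) ≃ₗ[R] (↥ω × X₂)))) ∧ ¬ ((Nonempty ((R × X₁) ≃ₗ[R] X₂)) ∧ (Nonempty ((R × X₁) ≃ₗ[R] (↥ω × X₂)))) := by
  have := hCM.1
  obtain ⟨d, hω'⟩ := ExtTools.isDualizing_of_isCanonicalModule hCM hω
  have hxm := ExtTools.mem_maximalIdeal_of_not_isGorensteinLocalRing hCM hnG hω hxω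
  refine ⟨ExtTools.nonempty_equiv_or_nonempty_equiv hCM hω' hxω hxreg hxm h₁ h₂, ?_⟩
  rintro ⟨⟨e⟩, ⟨e'⟩⟩
  have := h₂.1.2.2.1.1
  let g : X₂ ≃ₗ[R] ω × X₂ := e.symm.trans e'
  let f : X₂ →ₗ[R] X₂ := LinearMap.snd R ω X₂ ∘ₗ g.toLinearMap
  have hf : Function.Injective f := IsNoetherian.injective_of_surjective_endomorphism f
    ((LinearMap.snd_surjective (R := R)).comp g.surjective)
  have h0 : f (g.symm (⟨x, hxω⟩, 0)) = f 0 := by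
    simp [f]
  have h1 : ((⟨x, hxω⟩ : ω), (0 : X₂)) = 0 := by
    simpa using congrArg g (hf h0)
  have hx0 : x = 0 := congrArg (fun p => p.1.1) h1
  exact nonZeroDivisors.ne_zero hxreg hx0

end
end

section
/- Let (R,𝔪) be a Cohen-Macaulay local ring with canonical module that is generically Gorenstein and not Gorenstein, let ω be a canonical ideal of R, let x ∈ ω be an R-regular element, and set (ω/xR)^∨ := Ext^1_R(ω/xR, ω). Then δ_R(ω/xR) = 0 and δ_R((ω/xR)^∨) = 0, where δ_R(M) is Auslander's delta-invariant of M. -/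
open CategoryTheory

noncomputable section

open CochainComplex HomComplex in
lemma CategoryTheory.ProjectiveResolution.extMk_zero_degree_eq_zero_iff
    {C : Type*} [Category C] [Abelian C] [HasExt C] {X Y : C} (P : ProjectiveResolution X)
    (f : P.complex.X 0 ⟶ Y) (hf : P.complex.d 1 0 ≫ f = 0) :
    P.extMk f 1 rfl hf = 0 ↔ f = 0 := by
  simp only [← P.extEquivCohomologyClass.apply_eq_iff_eq,
    ProjectiveResolution.extEquivCohomologyClass_extMk,
    ProjectiveResolution.extEquivCohomologyClass_zero, CohomologyClass.mk_eq_zero_iff]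
  rw [Cocycle.toSingleMk_mem_coboundaries_iff _ _ _ _ _ 1 (by lia)]
  have h1 : P.cochainComplex.d (-(0 : ℕ)) 1 = 0 :=
    (CochainComplex.isZero_of_isStrictlyLE _ 0 _).eq_of_tgt _ _
  rw [h1]
  constructor
  · rintro ⟨g, hg⟩
    have hg' : (P.cochainComplexXIso (-(0 : ℕ)) 0 rfl).hom ≫ f = 0 := by
      rw [← hg, Limits.zero_comp]
    rwa [← cancel_epi (P.cochainComplexXIso (-(0 : ℕ)) 0 rfl).hom, Limits.comp_zero]
  · rintro rfl
    exact ⟨0, by simp⟩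

section

variable {R : Type} [CommRing R] {N : ModuleCat.{0} R}

/-- The morphism underlying a cycle of the complex `Hom(P, Y)`. -/
def cycleHom (P : ProjectiveResolution N) (Y : ModuleCat.{0} R) (n : ℕ) :
    (P.complex.linearYonedaObj R Y).cycles n →ₗ[R] (P.complex.X n ⟶ Y) :=
  ((P.complex.linearYonedaObj R Y).iCycles n).hom

lemma d_comp_cycleHom (P : ProjectiveResolution N) (Y : ModuleCat.{0} R) (n : ℕ)
    (z : (P.complex.linearYonedaObj R Y).cycles n) :
    P.complex.d (n + 1) n ≫ cycleHom P Y n z = 0 :=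
  congr($((P.complex.linearYonedaObj R Y).iCycles_d n (n + 1)) z)

/-- The class in `Ext^n(N, Y)` of a cycle of the complex `Hom(P, Y)`. -/
def extOfCycles (P : ProjectiveResolution N) (Y : ModuleCat.{0} R) (n : ℕ) :
    (P.complex.linearYonedaObj R Y).cycles n →ₗ[R] Abelian.Ext N Y n where
  toFun z := P.extMk (cycleHom P Y n z) (n + 1) rfl (d_comp_cycleHom P Y n z)
  map_add' z w := by
    rw [ProjectiveResolution.add_extMk]
    congr 1
    exact map_add _ z w
  map_smul' r z := by
    rw [Abelian.Ext.smul_eq_comp_mk₀, RingHom.id_apply, ProjectiveResolution.extMk_comp_mk₀]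
    congr 1
    simp

lemma extOfCycles_surjective (P : ProjectiveResolution N) (Y : ModuleCat.{0} R) (n : ℕ) :
    Function.Surjective (extOfCycles P Y n) := by
  intro α
  obtain ⟨f, hf, rfl⟩ := P.extMk_surjective α (n + 1) rfl
  let K := P.complex.linearYonedaObj R Y
  let z : K.cycles n := K.cyclesMk (i := n) f (n + 1) (by simp) hf
  refine ⟨z, ?_⟩
  have : cycleHom P Y n z = f := K.i_cyclesMk (i := n) f (n + 1) (by simp) hf
  simp only [extOfCycles, LinearMap.coe_mk, AddHom.coe_mk]
  congr 1

lemma ker_extOfCycles (P : ProjectiveResolution N) (Y : ModuleCat.{0} R) (n : ℕ) :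
    LinearMap.ker (extOfCycles P Y n) =
      LinearMap.ker ((P.complex.linearYonedaObj R Y).homologyπ n).hom := by
  let K := P.complex.linearYonedaObj R Y
  have hinj : Function.Injective (K.iCycles n) :=
    (ModuleCat.mono_iff_injective _).mp inferInstance
  have hex : (ShortComplex.mk (K.toCycles ((ComplexShape.up ℕ).prev n) n) (K.homologyπ n)
      (by simp)).Exact :=
    ShortComplex.exact_of_g_is_cokernel _ (K.homologyIsCokernel _ n rfl)
  rw [ShortComplex.moduleCat_exact_iff_ker_sub_range] at hex
  ext z
  have key : K.homologyπ n z = 0 ↔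
      ∃ g, K.d ((ComplexShape.up ℕ).prev n) n g = K.iCycles n z := by
    constructor
    · intro h
      obtain ⟨g, hg⟩ := hex h
      refine ⟨g, ?_⟩
      have : K.toCycles _ n g = z := hg
      rw [← this, ← ConcreteCategory.comp_apply, K.toCycles_i]
    · rintro ⟨g, hg⟩
      have : K.toCycles _ n g = z := hinj <| by
        rw [← hg, ← ConcreteCategory.comp_apply, K.toCycles_i]
      rw [← this, ← ConcreteCategory.comp_apply]
      simp
  simp only [LinearMap.mem_ker]
  refine Iff.trans ?_ key.symm
  simp only [extOfCycles, LinearMap.coe_mk, AddHom.coe_mk]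
  cases n with
  | zero =>
    rw [P.extMk_zero_degree_eq_zero_iff]
    have : K.d ((ComplexShape.up ℕ).prev 0) 0 = 0 := by simp
    rw [this]
    exact ⟨fun h ↦ ⟨0, h.symm⟩, fun ⟨_, h⟩ ↦ h.symm⟩
  | succ n =>
    rw [P.extMk_eq_zero_iff _ _ _ _ n rfl, CochainComplex.prev_nat_succ]
    rfl

/-- The Ext modules defined by projective resolutions agree with those of the derived category. -/
def modExtEquiv (n : ℕ) (N Y : ModuleCat.{0} R) :
    ((Ext R (ModuleCat R) n).obj (Opposite.op N)).obj Y ≃ₗ[R] Abelian.Ext N Y n :=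
  let P := projectiveResolution N
  (P.isoExt n Y).toLinearEquiv ≪≫ₗ
    (LinearMap.quotKerEquivOfSurjective ((P.complex.linearYonedaObj R Y).homologyπ n).hom
      ((ModuleCat.epi_iff_surjective _).mp inferInstance)).symm ≪≫ₗ
    Submodule.quotEquivOfEq _ _ (ker_extOfCycles P Y n).symm ≪≫ₗ
    LinearMap.quotKerEquivOfSurjective _ (extOfCycles_surjective P Y n)

section ExtVanishing

open CategoryTheory.Abelian.Ext

variable {S : ShortComplex (ModuleCat.{0} R)}

lemma subsingleton_ext_X₁ (hS : S.ShortExact) (Y : ModuleCat.{0} R) (i : ℕ)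
    (h₂ : Subsingleton (Abelian.Ext S.X₂ Y i)) (h₃ : Subsingleton (Abelian.Ext S.X₃ Y (i + 1))) :
    Subsingleton (Abelian.Ext S.X₁ Y i) :=
  subsingleton_of_forall_eq 0 fun x ↦ by
    obtain ⟨y, rfl⟩ := contravariant_sequence_exact₁ hS Y x (add_comm 1 i)
      (Subsingleton.elim _ _)
    rw [Subsingleton.elim y 0, comp_zero]

lemma subsingleton_ext_X₂ (hS : S.ShortExact) (Y : ModuleCat.{0} R) (i : ℕ)
    (h₁ : Subsingleton (Abelian.Ext S.X₁ Y i)) (h₃ : Subsingleton (Abelian.Ext S.X₃ Y i)) :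
    Subsingleton (Abelian.Ext S.X₂ Y i) :=
  subsingleton_of_forall_eq 0 fun x ↦ by
    obtain ⟨y, rfl⟩ := contravariant_sequence_exact₂ hS Y x (Subsingleton.elim _ _)
    rw [Subsingleton.elim y 0, comp_zero]

lemma subsingleton_ext_X₃ (hS : S.ShortExact) (Y : ModuleCat.{0} R) (i : ℕ)
    (h₁ : Subsingleton (Abelian.Ext S.X₁ Y i)) (h₂ : Subsingleton (Abelian.Ext S.X₂ Y (i + 1))) :
    Subsingleton (Abelian.Ext S.X₃ Y (i + 1)) :=
  subsingleton_of_forall_eq 0 fun x ↦ by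
    obtain ⟨y, rfl⟩ := contravariant_sequence_exact₃ hS Y x (Subsingleton.elim _ _)
      (add_comm 1 i)
    rw [Subsingleton.elim y 0, comp_zero]

end ExtVanishing

open scoped Pointwise in
instance (X : ModuleCat.{0} R) [Module.Finite R X] (r : R) :
    Module.Finite R (X.smulShortComplex r).X₃ :=
  inferInstanceAs (Module.Finite R (X ⧸ (r • (⊤ : Submodule R X))))

lemma mk₀_smul_id_comp {X Y : ModuleCat.{0} R} {i : ℕ} (r : R) (y : Abelian.Ext X Y i) :
    (Abelian.Ext.mk₀ (r • 𝟙 X)).comp y (zero_add i) = r • y := by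
  rw [Abelian.Ext.mk₀_smul, Abelian.Ext.smul_comp, Abelian.Ext.mk₀_id_comp]

lemma subsingleton_ext_projective (P Y : ModuleCat.{0} R) [Projective P] (i : ℕ) (hi : 0 < i) :
    Subsingleton (Abelian.Ext P Y i) := by
  obtain ⟨i, rfl⟩ := Nat.exists_eq_succ_of_ne_zero hi.ne'
  exact Abelian.Ext.subsingleton_of_projective _ _ _

lemma HasFiniteInjDim.exists_bound {Y : ModuleCat.{0} R} (hY : HasFiniteInjDim R Y) :
    ∃ b : ℕ, ∀ (N : ModuleCat.{0} R) (i : ℕ), b < i → Subsingleton (Abelian.Ext N Y i) := by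
  obtain ⟨b, hb⟩ := hY
  exact ⟨b, fun N i hi ↦ have := hb N i hi; (modExtEquiv i N Y).symm.subsingleton⟩

lemma HasFiniteInjDim.of_retract {Y Z : ModuleCat.{0} R} (hY : HasFiniteInjDim R Y)
    (i : Z ⟶ Y) (p : Y ⟶ Z) (hip : i ≫ p = 𝟙 Z) : HasFiniteInjDim R Z := by
  obtain ⟨b, hb⟩ := hY
  refine ⟨b, fun N j hj ↦ ?_⟩
  have := hb N j hj
  let F := (Ext R (ModuleCat R) j).obj (Opposite.op N)
  refine Function.Injective.subsingleton (f := F.map i) ?_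
  refine Function.LeftInverse.injective (g := F.map p) fun x ↦ ?_
  rw [← ConcreteCategory.comp_apply, ← F.map_comp, hip, F.map_id]
  rfl

variable [IsLocalRing R]

open IsLocalRing

/-- The residue field as an object of the category of modules. -/
abbrev residueModule (R : Type) [CommRing R] [IsLocalRing R] : ModuleCat.{0} R :=
  ModuleCat.of R (ResidueField R)

lemma annihilator_residueModule : Module.annihilator R (residueModule R) = maximalIdeal R :=
  Ideal.annihilator_quotient

instance : Module.Finite R (residueModule R) :=
  inferInstanceAs (Module.Finite R (R ⧸ maximalIdeal R))

lemma subsingleton_ext_of_smul_quotient [IsNoetherianRing R] {X Y : ModuleCat.{0} R}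
    [Module.Finite R X] [Module.Finite R Y] {r : R} (hr : r ∈ maximalIdeal R)
    (hreg : IsSMulRegular X r) (i : ℕ)
    (h : Subsingleton (Abelian.Ext (X.smulShortComplex r).X₃ Y (i + 1))) :
    Subsingleton (Abelian.Ext X Y i) := by
  have hle : (⊤ : Submodule R (Abelian.Ext X Y i)) ≤ maximalIdeal R • ⊤ := by
    intro x _
    obtain ⟨y, hy⟩ := Abelian.Ext.contravariant_sequence_exact₁
      hreg.smulShortComplex_shortExact Y x (add_comm 1 i) (Subsingleton.elim _ _)
    have : r • (show Abelian.Ext X Y i from y) = x := (mk₀_smul_id_comp r y).symm.trans hy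
    rw [← this]
    exact Submodule.smul_mem_smul hr trivial
  have := Submodule.eq_bot_of_le_smul_of_le_jacobson_bot _ _ (Module.Finite.fg_top) hle
    (maximalIdeal_le_jacobson _)
  exact (Submodule.subsingleton_iff R).mp (subsingleton_of_bot_eq_top this.symm)

/-- If the residue field embeds in a module `Q` with `Ext^i(Q, Y) = 0` for `i > e`, and `Y` has
finite injective dimension, then `Ext^i(N, Y) = 0` for `i > e` and all finite `N`. -/
lemma subsingleton_ext_of_residue_embedding [IsNoetherianRing R] {Y Q : ModuleCat.{0} R}
    [Module.Finite R Y] [Module.Finite R Q] (b e : ℕ)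
    (hY : ∀ (N : ModuleCat.{0} R) (i : ℕ), b < i → Subsingleton (Abelian.Ext N Y i))
    (f : residueModule R →ₗ[R] Q) (hf : Function.Injective f)
    (hQ : ∀ i, e < i → Subsingleton (Abelian.Ext Q Y i))
    (N : ModuleCat.{0} R) [hN : Module.Finite R N] (i : ℕ) (hi : e < i) :
    Subsingleton (Abelian.Ext N Y i) := by
  suffices ∀ (c i : ℕ), e < i → b < i + c → ∀ (N : ModuleCat.{0} R), Module.Finite R N →
      Subsingleton (Abelian.Ext N Y i) from this (b + 1) i hi (by lia) N hN
  intro c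
  induction c with
  | zero => exact fun i _ hb N _ ↦ hY N i hb
  | succ c ih =>
    intro i hi hb N hN
    have hk : Subsingleton (Abelian.Ext (residueModule R) Y i) := by
      have hS : (ModuleCat.shortComplexOfCompEqZero f f.range.mkQ
          (LinearMap.range_mkQ_comp f)).ShortExact :=
        { exact := ModuleCat.shortComplex_exact _ (LinearMap.exact_map_mkQ_range f)
          mono_f := (ModuleCat.mono_iff_injective _).mpr hf
          epi_g := (ModuleCat.epi_iff_surjective _).mpr (Submodule.mkQ_surjective _) }
      exact subsingleton_ext_X₁ hS Y i (hQ i hi)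
        (ih (i + 1) (by lia) (by lia) _ (inferInstanceAs (Module.Finite R (Q ⧸ f.range))))
    refine IsNoetherianRing.induction_on_isQuotientEquivQuotientPrime R (M := N) hN
      (motive := fun N _ _ _ ↦ Subsingleton (Abelian.Ext (ModuleCat.of R N) Y i)) ?_ ?_ ?_
    · intro N _ _ _ _
      exact subsingleton_of_forall_eq 0 fun x ↦ by
        rw [← Abelian.Ext.mk₀_id_comp x,
          (ModuleCat.isZero_of_subsingleton (ModuleCat.of R N)).eq_of_src (𝟙 _) 0]
        simp
    · intro N _ _ _ p g
      by_cases hp : p.1 = maximalIdeal R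
      · let g' : N ≃ₗ[R] ResidueField R := g ≪≫ₗ Submodule.quotEquivOfEq _ _ hp
        exact subsingleton_of_forall_eq 0 fun x ↦ by
          rw [← Abelian.Ext.mk₀_id_comp x, ← g'.toModuleIso.hom_inv_id,
            ← Abelian.Ext.mk₀_comp_mk₀, Abelian.Ext.comp_assoc_of_second_deg_zero,
            Subsingleton.elim ((Abelian.Ext.mk₀ g'.toModuleIso.inv).comp x (zero_add i)) 0,
            Abelian.Ext.comp_zero]
      · obtain ⟨r, hr, hrp⟩ := SetLike.exists_of_lt
          (lt_of_le_of_ne (le_maximalIdeal p.2.ne_top) hp)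
        have hreg : IsSMulRegular N r := by
          rw [g.isSMulRegular_congr, isSMulRegular_iff_right_eq_zero_of_smul]
          intro x hx
          obtain ⟨y, rfl⟩ := Ideal.Quotient.mk_surjective x
          rw [← Ideal.Quotient.mk_eq_mk, ← Submodule.Quotient.mk_smul, smul_eq_mul,
            Ideal.Quotient.mk_eq_mk, Ideal.Quotient.eq_zero_iff_mem] at hx
          exact Ideal.Quotient.eq_zero_iff_mem.mpr ((p.2.mem_or_mem hx).resolve_left hrp)
        refine subsingleton_ext_of_smul_quotient (X := ModuleCat.of R N) hr hreg i
          (ih (i + 1) (by lia) (by lia) _ inferInstance)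
    · intro N₁ _ _ _ N₂ _ _ _ N₃ _ _ _ f g hf hg hfg h₁ h₃
      have hS : (ModuleCat.shortComplexOfCompEqZero f g hfg.linearMap_comp_eq_zero).ShortExact :=
        { exact := ModuleCat.shortComplex_exact _ hfg
          mono_f := (ModuleCat.mono_iff_injective _).mpr hf
          epi_g := (ModuleCat.epi_iff_surjective _).mpr hg }
      exact subsingleton_ext_X₂ hS Y i h₁ h₃

lemma subsingleton_residue_linearMap {X : ModuleCat.{0} R}
    (h : Subsingleton (Abelian.Ext (residueModule R) X 0)) :
    Subsingleton (residueModule R →ₗ[R] X) :=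
  ((Abelian.Ext.linearEquiv₀ (R := R)).trans ModuleCat.homLinearEquiv).symm.subsingleton

lemma exists_isSMulRegular_of_ext [IsNoetherianRing R] {X : ModuleCat.{0} R} [Module.Finite R X]
    (h : Subsingleton (Abelian.Ext (residueModule R) X 0)) :
    ∃ r ∈ maximalIdeal R, IsSMulRegular X r := by
  have := IsSMulRegular.subsingleton_linearMap_iff.mp (subsingleton_residue_linearMap h)
  rwa [annihilator_residueModule] at this

lemma subsingleton_ext_residue_quotient {X : ModuleCat.{0} R} {r : R}
    (hreg : IsSMulRegular X r) (j : ℕ)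
    (h : Subsingleton (Abelian.Ext (residueModule R) X j))
    (h' : Subsingleton (Abelian.Ext (residueModule R) X (j + 1))) :
    Subsingleton (Abelian.Ext (residueModule R) (X.smulShortComplex r).X₃ j) :=
  subsingleton_of_forall_eq 0 fun x ↦ by
    obtain ⟨y, rfl⟩ := Abelian.Ext.covariant_sequence_exact₃ _
      hreg.smulShortComplex_shortExact x rfl (h'.elim _ _)
    exact (congrArg (fun y ↦ Abelian.Ext.comp y _ _) (h.elim y 0)).trans
      (Abelian.Ext.zero_comp ..)

lemma nontrivial_ext_residue_quotient {X : ModuleCat.{0} R} {r : R} (hr : r ∈ maximalIdeal R)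
    (hreg : IsSMulRegular X r) (j : ℕ)
    (h : Nontrivial (Abelian.Ext (residueModule R) X (j + 1))) :
    Nontrivial (Abelian.Ext (residueModule R) (X.smulShortComplex r).X₃ j) := by
  by_contra hn
  rw [not_nontrivial_iff_subsingleton] at hn
  rw [← annihilator_residueModule] at hr
  refine not_subsingleton_iff_nontrivial.mpr h (subsingleton_of_forall_eq 0 fun x ↦ ?_)
  obtain ⟨y, rfl⟩ := Abelian.Ext.covariant_sequence_exact₁ _
    hreg.smulShortComplex_shortExact x
    (congr($(Abelian.Ext.postcomp_smul_id_eq_zero_of_mem_annihilator (M := X) hr (j + 1)) x)) rfl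
  exact (congrArg (fun y ↦ Abelian.Ext.comp y _ _) (hn.elim y 0)).trans (Abelian.Ext.zero_comp ..)

/-- Killing a maximal regular sequence on `Q` produces a module containing the residue field. -/
lemma exists_residue_embedding [IsNoetherianRing R] {Y : ModuleCat.{0} R} (n e : ℕ)
    (Q : ModuleCat.{0} R) (hfin : Module.Finite R Q)
    (hlt : ∀ j < n, Subsingleton (Abelian.Ext (residueModule R) Q j))
    (hn : Nontrivial (Abelian.Ext (residueModule R) Q n))
    (hQ : ∀ i, e < i → Subsingleton (Abelian.Ext Q Y i)) :
    ∃ (Q' : ModuleCat.{0} R) (f : residueModule R →ₗ[R] Q'), Module.Finite R Q' ∧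
      Function.Injective f ∧ ∀ i, e + n < i → Subsingleton (Abelian.Ext Q' Y i) := by
  induction n generalizing Q e with
  | zero =>
    have : Nontrivial (residueModule R →ₗ[R] Q) :=
      ((Abelian.Ext.linearEquiv₀ (R := R)).trans ModuleCat.homLinearEquiv).symm.nontrivial
    obtain ⟨f, hf⟩ := exists_ne (0 : residueModule R →ₗ[R] Q)
    refine ⟨Q, f, hfin, ?_, hQ⟩
    have : IsSimpleModule R (residueModule R) :=
      isSimpleModule_iff_quot_maximal.mpr ⟨maximalIdeal R, inferInstance, ⟨LinearEquiv.refl R _⟩⟩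
    exact f.injective_or_eq_zero.resolve_right hf
  | succ n ih =>
    obtain ⟨r, hr, hreg⟩ := exists_isSMulRegular_of_ext (hlt 0 (by lia))
    obtain ⟨Q', f, h₁, h₂, h₃⟩ := ih (e + 1) (Q.smulShortComplex r).X₃
      inferInstance
      (fun j hj ↦ subsingleton_ext_residue_quotient hreg j (hlt j (by lia)) (hlt _ (by lia)))
      (nontrivial_ext_residue_quotient hr hreg n hn)
      (fun i hi ↦ by
        obtain ⟨i, rfl⟩ := Nat.exists_eq_succ_of_ne_zero (by lia : i ≠ 0)
        exact subsingleton_ext_X₃ hreg.smulShortComplex_shortExact Y i (hQ _ (by lia))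
          (hQ _ (by lia)))
    exact ⟨Q', f, h₁, h₂, fun i hi ↦ h₃ i (by lia)⟩

/-- Ischebeck's vanishing: if `Ext^i(N, Y) = 0` for `i > d` and all finite `N`, then
`Ext^i(X, Y) = 0` for `i > d - depth X`. -/
lemma subsingleton_ext_of_depth [IsNoetherianRing R] {Y : ModuleCat.{0} R} [Module.Finite R Y]
    (d : ℕ) (hY : ∀ (N : ModuleCat.{0} R) (i : ℕ), Module.Finite R N → d < i →
      Subsingleton (Abelian.Ext N Y i))
    (n : ℕ) (X : ModuleCat.{0} R) (hfin : Module.Finite R X)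
    (hX : ∀ j < n, Subsingleton (Abelian.Ext (residueModule R) X j)) (i : ℕ) (hi : d < i + n) :
    Subsingleton (Abelian.Ext X Y i) := by
  induction n generalizing X i with
  | zero => exact hY X i hfin hi
  | succ n ih =>
    obtain ⟨r, hr, hreg⟩ := exists_isSMulRegular_of_ext (hX 0 (by lia))
    exact subsingleton_ext_of_smul_quotient hr hreg i (ih (X.smulShortComplex r).X₃
      inferInstance
      (fun j hj ↦ subsingleton_ext_residue_quotient hreg j (hX j (by lia)) (hX _ (by lia)))
      (i + 1) (by lia))

/-- A module of finite injective dimension over a ring which is not Gorenstein does not surject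
onto the ring. -/
lemma not_surjective_of_hasFiniteInjDim [IsNoetherianRing R] (hnG : ¬ IsGorensteinLocalRing R)
    {Y : ModuleCat.{0} R} (hY : HasFiniteInjDim R Y) (f : Y →ₗ[R] R) :
    ¬ Function.Surjective f := by
  intro hf
  obtain ⟨y, hy⟩ := hf 1
  refine hnG ⟨inferInstance, inferInstance, hY.of_retract
    (ModuleCat.ofHom (LinearMap.toSpanSingleton R Y y)) (ModuleCat.ofHom f) ?_⟩
  ext
  simp [hy]

lemma ext_residue_of_moduleDepth {M : ModuleCat.{0} R} {d : ℕ} (h : moduleDepth R M = d) :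
    (∀ j < d, Subsingleton (Abelian.Ext (residueModule R) M j)) ∧
      Nontrivial (Abelian.Ext (residueModule R) M d) := by
  constructor
  · intro j hj
    by_contra hn
    rw [not_subsingleton_iff_nontrivial] at hn
    have : moduleDepth R M ≤ j := sInf_le ⟨j, rfl, (modExtEquiv j _ M).toEquiv.nontrivial⟩
    rw [h] at this
    exact absurd (by exact_mod_cast this : d ≤ j) (by lia)
  · have hne : {n : ℕ∞ | ∃ m : ℕ, n = (m : ℕ∞) ∧
        Nontrivial (ModExt R m (residueModule R) M)}.Nonempty := by
      rw [Set.nonempty_iff_ne_empty]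
      intro he
      rw [moduleDepth, he, sInf_empty] at h
      exact ENat.top_ne_natCast d h
    obtain ⟨m, hm, hnt⟩ := csInf_mem hne
    obtain rfl : d = m := by exact_mod_cast h.symm.trans hm
    exact (modExtEquiv d _ M).symm.toEquiv.nontrivial

/-- Over a Cohen-Macaulay local ring, `Ext^1(ω, Y) = 0` for `Y` of finite injective dimension. -/
lemma IsCanonicalModule.subsingleton_ext_one (hCM : IsCMLocalRing R) {W : ModuleCat.{0} R}
    (hW : IsCanonicalModule R W) {Y : ModuleCat.{0} R} [Module.Finite R Y]
    (hY : HasFiniteInjDim R Y) : Subsingleton (Abelian.Ext W Y 1) := by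
  obtain ⟨hNoeth, hdepth⟩ := hCM
  obtain ⟨hWfin, -, d, hd, -, hWext⟩ := hW
  have hdepth' : moduleDepth R (ModuleCat.of R R) = d := by
    rw [hd] at hdepth
    exact_mod_cast hdepth
  obtain ⟨hlt, hnt⟩ := ext_residue_of_moduleDepth hdepth'
  obtain ⟨b, hb⟩ := hY.exists_bound
  obtain ⟨Q, f, hQfin, hf, hQ⟩ := exists_residue_embedding (Y := Y) d 0 (ModuleCat.of R R)
    inferInstance hlt hnt (fun i hi ↦ subsingleton_ext_projective _ _ i hi)
  refine subsingleton_ext_of_depth d (fun N i _ hi ↦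
    subsingleton_ext_of_residue_embedding b d hb f hf (fun i hi ↦ hQ i (by lia)) N i hi)
    d W hWfin (fun j hj ↦ ?_) 1 (by lia)
  have := hWext j hj.ne
  exact (modExtEquiv j _ W).symm.subsingleton

/-- If `M` is a quotient of a canonical module over a non-Gorenstein Cohen-Macaulay local ring,
then the maximal Cohen-Macaulay approximations of `M` have no free summand. -/
lemma IsMCMApprox.freeRank_eq_zero (hCM : IsCMLocalRing R) (hnG : ¬ IsGorensteinLocalRing R)
    {W : ModuleCat.{0} R} (hW : IsCanonicalModule R W) {M Y X : ModuleCat.{0} R}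
    {ι : Y →ₗ[R] X} {π : X →ₗ[R] M} (h : IsMCMApprox R M Y X ι π)
    (p : W →ₗ[R] M) (hp : Function.Surjective p) : freeRank R X = 0 := by
  obtain ⟨-, hYfin, -, hYinj, hι, hπ, hex⟩ := h
  have hNoeth := hCM.1
  have hext := hW.subsingleton_ext_one hCM hYinj
  obtain ⟨q, hq⟩ : ∃ q : W →ₗ[R] X, ∀ w, π (q w) = p w := by
    have hS : (ModuleCat.shortComplexOfCompEqZero ι π hex.linearMap_comp_eq_zero).ShortExact :=
      { exact := ModuleCat.shortComplex_exact _ hex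
        mono_f := (ModuleCat.mono_iff_injective _).mpr hι
        epi_g := (ModuleCat.epi_iff_surjective _).mpr hπ }
    obtain ⟨y, hy⟩ := Abelian.Ext.covariant_sequence_exact₃ W hS
      (Abelian.Ext.mk₀ (ModuleCat.ofHom p)) rfl (hext.elim _ _)
    obtain ⟨q, rfl⟩ := (Abelian.Ext.mk₀_bijective _ _).surjective y
    rw [Abelian.Ext.mk₀_comp_mk₀] at hy
    have := (Abelian.Ext.mk₀_bijective _ _).injective hy
    exact ⟨q.hom, fun w ↦ congr($this w)⟩
  refine le_antisymm (sSup_le ?_) zero_le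
  rintro _ ⟨m, rfl, X', ⟨e⟩⟩
  rcases m.eq_zero_or_pos with rfl | hm
  · simp
  exfalso
  let g : X →ₗ[R] R := LinearMap.proj ⟨0, hm⟩ ∘ₗ LinearMap.fst R _ _ ∘ₗ e.toLinearMap
  have hg : Function.Surjective g :=
    (Function.surjective_eval (⟨0, hm⟩ : Fin m)).comp
      (Prod.fst_surjective.comp e.surjective)
  have hle {Z : ModuleCat.{0} R} (hZ : HasFiniteInjDim R Z) (f : Z →ₗ[R] R) (z : Z) :
      f z ∈ maximalIdeal R :=
    le_maximalIdeal (J := LinearMap.range f) (fun ht ↦ not_surjective_of_hasFiniteInjDim hnG hZ f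
      (LinearMap.range_eq_top.mp ht)) ⟨z, rfl⟩
  obtain ⟨x, hx⟩ := hg 1
  obtain ⟨w, hw⟩ := hp (π x)
  obtain ⟨y, hy⟩ := (hex (x - q w)).mp (by rw [map_sub, hq, hw, sub_self])
  have h1 : (1 : R) = (g ∘ₗ ι) y + (g ∘ₗ q) w := by
    simp [hy, hx]
  have : (1 : R) ∈ maximalIdeal R := by
    rw [h1]
    exact add_mem (hle hYinj _ y) (hle hW.2.1 _ w)
  exact (Ideal.ne_top_iff_one _).mp (maximalIdeal.isMaximal R).ne_top this

/-- For a regular element `x` of a canonical ideal `ω`, the module `Ext^1(ω/xR, ω)` is a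
quotient of `ω`. -/
lemma IsCanonicalIdeal.exists_surjective_modExt (hCM : IsCMLocalRing R) {ω : Ideal R}
    (hω : IsCanonicalIdeal R ω) {x : R} (hxω : x ∈ ω) (hx : x ∈ nonZeroDivisors R) :
    ∃ p : ω →ₗ[R] ModExt R 1 (qmod R ω (Ideal.span {x})) (ModuleCat.of R ω),
      Function.Surjective p := by
  have hfin : Module.Finite R (ModuleCat.of R ω) := hω.1
  have hext := IsCanonicalModule.subsingleton_ext_one hCM hω hω.2.1
  let f : R →ₗ[R] ω := LinearMap.toSpanSingleton R ω ⟨x, hxω⟩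
  let g := (Submodule.comap ω.subtype (Ideal.span {x})).mkQ
  have hfg : Function.Exact f g := by
    intro a
    rw [Submodule.mkQ_apply, Submodule.Quotient.mk_eq_zero, Submodule.mem_comap,
      Submodule.subtype_apply, Ideal.mem_span_singleton']
    refine exists_congr fun r ↦ ?_
    rw [Subtype.ext_iff]
    simp [f]
  have hS : (ModuleCat.shortComplexOfCompEqZero f g hfg.linearMap_comp_eq_zero).ShortExact :=
    { exact := ModuleCat.shortComplex_exact _ hfg
      mono_f := (ModuleCat.mono_iff_injective _).mpr fun a b hab ↦
        (mul_cancel_right_mem_nonZeroDivisors hx).mp congr(Subtype.val $hab)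
      epi_g := (ModuleCat.epi_iff_surjective _).mpr (Submodule.mkQ_surjective _) }
  let e : ω ≃ₗ[R] Abelian.Ext (ModuleCat.of R R) (ModuleCat.of R ω) 0 :=
    (LinearMap.ringLmapEquivSelf R R ω).symm ≪≫ₗ
      (ModuleCat.homLinearEquiv (M := ModuleCat.of R R) (N := ModuleCat.of R ω)).symm ≪≫ₗ
      Abelian.Ext.linearEquiv₀.symm
  let δ : Abelian.Ext (ModuleCat.of R R) (ModuleCat.of R ω) 0 →ₗ[R]
      Abelian.Ext (qmod R ω (Ideal.span {x})) (ModuleCat.of R ω) 1 :=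
    hS.extClass.precompOfLinear R (ModuleCat.of R ω) (add_zero 1)
  have hδ : Function.Surjective δ := fun y ↦
    Abelian.Ext.contravariant_sequence_exact₃ hS _ y (hext.elim _ _) (add_zero 1)
  exact ⟨(modExtEquiv 1 _ _).symm.toLinearMap ∘ₗ δ ∘ₗ e.toLinearMap,
    (modExtEquiv 1 _ _).symm.surjective.comp (hδ.comp e.surjective)⟩

end

theorem stmt2 (R : Type) [CommRing R] [IsLocalRing R]
    (hCM : IsCMLocalRing R) (hGG : IsGenericallyGorenstein R)
    (hnG : ¬ IsGorensteinLocalRing R)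
    (ω : Ideal R) (hω : IsCanonicalIdeal R ω)
    (x : R) (hxω : x ∈ ω) (hxreg : x ∈ nonZeroDivisors R) :
    (∀ (Y X : ModuleCat R) (ι : Y →ₗ[R] X) (π : X →ₗ[R] qmod R ω (Ideal.span {x})),
        IsMinMCMApprox R (qmod R ω (Ideal.span {x})) Y X ι π → freeRank R X = 0) ∧
    (∀ (Y X : ModuleCat R) (ι : Y →ₗ[R] X) (π : X →ₗ[R] ModExt R 1 (qmod R ω (Ideal.span {x})) (ModuleCat.of R ↥ω)),
        IsMinMCMApprox R (ModExt R 1 (qmod R ω (Ideal.span {x})) (ModuleCat.of R ↥ω)) Y X ι π → freeRank R X = 0) := by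
  refine ⟨fun Y X ι π h ↦ h.1.freeRank_eq_zero hCM hnG hω _ (Submodule.mkQ_surjective _), ?_⟩
  obtain ⟨p, hp⟩ := hω.exists_surjective_modExt hCM hxω hxreg
  exact fun Y X ι π h ↦ h.1.freeRank_eq_zero hCM hnG hω p hp

end
end
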